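/- arXiv:0710.2340 — 6 statements merged into one kernel-verified Lean document; each statement's English description precedes it below -/
import Mathlib

section
/- Let l ≥ 6 be an integer and let K be a totally real number field with ℚ(cos(2π/l)) ⊆ K and K = ℚ(α), where α is an algebraic integer such that for every real embedding σ : K → ℝ other than the identity, −3.1·σ(sin²(π/l)) < σ(α) < 3.1·σ(sin²(π/l)), while 2⁵ < α < 14⁵. Then [K : ℚ] ≤ 99. -/
open Polynomial IntermediateField

theorem isIntegral_ofNat {R : Type*} [CommRing R] (n : ℕ) [n.AtLeastTwo] :
    IsIntegral ℤ (OfNat.ofNat n : R) := by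
  exact_mod_cast isIntegral_algebraMap (R := ℤ) (A := R) (x := (n : ℤ))

theorem norm_sub_one_of_isPrimitiveRoot {F : Type*} [Field F] [NumberField F] {l : ℕ} (hl : 2 < l)
    {ζ : F} (hζ : IsPrimitiveRoot ζ l) :
    ∃ m : ℕ, l.totient * m = Module.finrank ℚ F ∧
      Algebra.norm ℚ (ζ - 1) = ((eval 1 (cyclotomic l ℤ) : ℤ) : ℚ) ^ m := by
  have : NeZero l := ⟨by omega⟩
  have hirr := cyclotomic.irreducible_rat (n := l) (by omega)
  have hC : IsCyclotomicExtension {l} ℚ ℚ⟮ζ⟯ :=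
    hζ.intermediateField_adjoin_isCyclotomicExtension ℚ
  have hμ : IsPrimitiveRoot (AdjoinSimple.gen ℚ ζ) l := IsPrimitiveRoot.coe_submonoidClass_iff.mp hζ
  refine ⟨Module.finrank ℚ⟮ζ⟯ F, ?_, ?_⟩
  · rw [← IsCyclotomicExtension.finrank (K := ℚ) ℚ⟮ζ⟯ hirr, Module.finrank_mul_finrank]
  · rw [show ζ - 1 = algebraMap ℚ⟮ζ⟯ F (AdjoinSimple.gen ℚ ζ - 1) by rfl,
      ← Algebra.norm_norm (S := ℚ⟮ζ⟯), Algebra.norm_algebraMap, map_pow,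
      hμ.sub_one_norm_eq_eval_cyclotomic hl hirr]

theorem finrank_and_norm_adjoin_of_quadratic {k L : Type*} [Field k] [Field L] [Algebra k L] {x : L}
    {b c : k} (hx : x ^ 2 + algebraMap k L b * x + algebraMap k L c = 0)
    (hxk : x ∉ (algebraMap k L).range) :
    Module.finrank k k⟮x⟯ = 2 ∧ Algebra.norm k (AdjoinSimple.gen k x) = c := by
  set q : k[X] := X ^ 2 + C b * X + C c with hq
  have hdeg : q.natDegree = 2 := by rw [hq]; compute_degree!
  have hmon : q.Monic := by rw [hq]; monicity!
  have hroot : aeval x q = 0 := by simp [hq, hx]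
  have hint : IsIntegral k x := ⟨q, hmon, hroot⟩
  have hmin : minpoly k x = q := by
    refine (eq_of_monic_of_dvd_of_natDegree_le (minpoly.monic hint) hmon
      (minpoly.dvd k x hroot) ?_).symm
    rw [hdeg]
    exact (minpoly.two_le_natDegree_iff hint).2 hxk
  refine ⟨by rw [adjoin.finrank hint, hmin, hdeg], ?_⟩
  have h := Algebra.PowerBasis.norm_gen_eq_coeff_zero_minpoly (adjoin.powerBasis hint)
  rw [adjoin.powerBasis_gen, adjoin.powerBasis_dim, minpoly_gen, hmin, hdeg] at h
  rw [h]
  simp [hq]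

theorem norm_of_quadratic_isPrimitiveRoot {K L : Type*} [Field K] [NumberField K] [Field L]
    [Algebra K L] {l : ℕ} (hl : 2 < l) {ζ : L} (hζ : IsPrimitiveRoot ζ l) {s : K}
    (hquad : (ζ - 1) ^ 2 + algebraMap K L s * (ζ - 1) + algebraMap K L s = 0)
    (hnot : ζ - 1 ∉ (algebraMap K L).range) :
    ∃ m : ℕ, l.totient * m = 2 * Module.finrank ℚ K ∧
      Algebra.norm ℚ s = ((eval 1 (cyclotomic l ℤ) : ℤ) : ℚ) ^ m := by
  obtain ⟨hfin, hnorm⟩ := finrank_and_norm_adjoin_of_quadratic hquad hnot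
  have : CharZero L := charZero_of_injective_algebraMap (algebraMap K L).injective
  have : FiniteDimensional K K⟮ζ - 1⟯ := Module.finite_of_finrank_pos (by omega)
  have : FiniteDimensional ℚ K⟮ζ - 1⟯ := Module.Finite.trans K _
  have : NumberField K⟮ζ - 1⟯ := { }
  have hμ : IsPrimitiveRoot (AdjoinSimple.gen K (ζ - 1) + 1) l := by
    apply IsPrimitiveRoot.of_map_of_injective (f := algebraMap K⟮ζ - 1⟯ L) _
      (algebraMap K⟮ζ - 1⟯ L).injective
    simpa using hζ
  obtain ⟨m, hm, hN⟩ := norm_sub_one_of_isPrimitiveRoot hl hμ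
  refine ⟨m, ?_, ?_⟩
  · rw [hm, ← Module.finrank_mul_finrank ℚ K K⟮ζ - 1⟯, hfin, mul_comm]
  · rw [← hN, add_sub_cancel_right, ← Algebra.norm_norm (S := K) (A := K⟮ζ - 1⟯), hnorm]

/-- The norm of `2 - 2 cos (2π/l) = 4 sin² (π/l)` is a power of `Φ_l(1)`. -/
theorem norm_two_sub_two_cos (K : IntermediateField ℚ ℝ) [FiniteDimensional ℚ K] {l : ℕ}
    (hl : 2 < l) {s : K} (hs : (s : ℝ) = 2 - 2 * Real.cos (2 * Real.pi / l)) :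
    ∃ m : ℕ, l.totient * m = 2 * Module.finrank ℚ K ∧
      Algebra.norm ℚ s = ((eval 1 (cyclotomic l ℤ) : ℤ) : ℚ) ^ m := by
  set ζ : ℂ := Complex.exp (2 * Real.pi * Complex.I / l) with hζdef
  have hζ : IsPrimitiveRoot ζ l := Complex.isPrimitiveRoot_exp l (by omega)
  have hζ' : ζ = Real.cos (2 * Real.pi / l) + Real.sin (2 * Real.pi / l) * Complex.I := by
    rw [hζdef, Complex.ofReal_cos, Complex.ofReal_sin, ← Complex.exp_mul_I]
    congr 1
    push_cast
    ring
  have hsin : 0 < Real.sin (2 * Real.pi / l) := by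
    apply Real.sin_pos_of_pos_of_lt_pi
    · positivity
    · rw [div_lt_iff₀ (by positivity), mul_comm]
      have : (2 : ℝ) < l := by exact_mod_cast hl
      gcongr
  have hsC : algebraMap K ℂ s = 2 - 2 * (Real.cos (2 * Real.pi / l) : ℂ) := by
    have : algebraMap K ℂ s = ((s : ℝ) : ℂ) := rfl
    rw [this, hs]
    push_cast
    ring
  have hquad : (ζ - 1) ^ 2 + algebraMap K ℂ s * (ζ - 1) + algebraMap K ℂ s = 0 := by
    have h1 : (Real.sin (2 * Real.pi / l) : ℂ) ^ 2 + (Real.cos (2 * Real.pi / l) : ℂ) ^ 2 = 1 := by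
      exact_mod_cast Real.sin_sq_add_cos_sq _
    rw [hsC, hζ']
    linear_combination (-1 : ℂ) * h1 + (Real.sin (2 * Real.pi / l) : ℂ) ^ 2 * Complex.I_sq
  have hnot : ζ - 1 ∉ (algebraMap K ℂ).range := by
    rintro ⟨x, hx⟩
    have h1 : (algebraMap K ℂ x).im = 0 := Complex.ofReal_im (x : ℝ)
    rw [hx, hζ'] at h1
    simp only [Complex.sub_im, Complex.add_im, Complex.ofReal_im,
      Complex.im_ofReal_mul, Complex.I_im, Complex.one_im] at h1
    linarith
  have : NumberField K := { }
  exact norm_of_quadratic_isPrimitiveRoot hl hζ hquad hnot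

theorem exists_real_embedding {K : Type*} [Field K] (σ : K →+* ℂ) (hσ : ∀ x, (σ x).im = 0) :
    ∃ ρ : K →+* ℝ, ∀ x, σ x = (ρ x : ℂ) := by
  have h : ∀ x, σ x = ((σ x).re : ℂ) := fun x ↦ Complex.ext rfl (by simp [hσ x])
  refine ⟨⟨⟨⟨fun x ↦ (σ x).re, by simp⟩, fun x y ↦ ?_⟩, by simp, fun x y ↦ by simp⟩, h⟩
  simp [hσ x]

theorem one_le_abs_norm {K : Type*} [Field K] [NumberField K] {P : K} (hP : IsIntegral ℤ P)
    (hP0 : P ≠ 0) : 1 ≤ |Algebra.norm ℚ P| := by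
  obtain ⟨z, hz⟩ := IsIntegrallyClosed.isIntegral_iff.1 (Algebra.isIntegral_norm ℚ hP)
  have hz' : (z : ℚ) = Algebra.norm ℚ P := by simpa using hz
  have h0 : z ≠ 0 := by
    rintro rfl
    exact hP0 (by simpa using hz'.symm)
  rw [← hz']
  exact_mod_cast Int.one_le_abs h0

/-- Lower bound `1 ≤ |N(P)|` combined with upper bounds for all conjugates of `P` in terms of those
of `s`. -/
theorem le_mul_norm_of_conjugates_le (K : IntermediateField ℚ ℝ) [FiniteDimensional ℚ K]
    (htr : ∀ σ : K →+* ℂ, ∀ x : K, (σ x).im = 0) {s P : K} (hP : IsIntegral ℤ P) (hP0 : P ≠ 0)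
    {C H : ℝ} {e : ℕ} (hC : 0 < C) (hs : 0 < (s : ℝ)) (hH : |(P : ℝ)| ≤ H)
    (hρ : ∀ ρ : K →+* ℝ, ρ ≠ algebraMap K ℝ → 0 < ρ s ∧ |ρ P| ≤ C * ρ s ^ e) :
    C * (s : ℝ) ^ e ≤
      H * (C ^ Module.finrank ℚ K * |((Algebra.norm ℚ s : ℚ) : ℝ)| ^ e) := by
  classical
  have : NumberField K := { }
  have hprod : ∀ x : K, |((Algebra.norm ℚ x : ℚ) : ℝ)| = ∏ σ : K →ₐ[ℚ] ℂ, ‖σ x‖ := fun x ↦ by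
    rw [← norm_prod, ← Algebra.norm_eq_prod_embeddings ℚ ℂ x, eq_ratCast,
      ← Complex.ofReal_ratCast, Complex.norm_real, Real.norm_eq_abs]
  set σ₀ : K →ₐ[ℚ] ℂ := IsScalarTower.toAlgHom ℚ K ℂ with hσ₀
  have hσ₀x : ∀ x : K, ‖σ₀ x‖ = |(x : ℝ)| := fun x ↦ Complex.norm_real _
  have hother : ∀ σ : K →ₐ[ℚ] ℂ, σ ≠ σ₀ → 0 < ‖σ s‖ ∧ ‖σ P‖ ≤ C * ‖σ s‖ ^ e := by
    intro σ hσ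
    obtain ⟨ρ, hρσ⟩ := exists_real_embedding (σ : K →+* ℂ) (htr _)
    have hne : ρ ≠ algebraMap K ℝ := by
      rintro rfl
      exact hσ (AlgHom.ext fun x ↦ hρσ x)
    have hval : ∀ x, ‖σ x‖ = |ρ x| := fun x ↦ by
      have : σ x = (ρ x : ℂ) := hρσ x
      rw [this, Complex.norm_real, Real.norm_eq_abs]
    obtain ⟨h1, h2⟩ := hρ ρ hne
    rw [hval, hval, abs_of_pos h1]
    exact ⟨h1, h2⟩
  have hone : (1 : ℝ) ≤ |((Algebra.norm ℚ P : ℚ) : ℝ)| := by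
    exact_mod_cast one_le_abs_norm hP hP0
  have hall : ∏ σ : K →ₐ[ℚ] ℂ, (C * ‖σ s‖ ^ e) =
      C ^ Module.finrank ℚ K * |((Algebra.norm ℚ s : ℚ) : ℝ)| ^ e := by
    rw [Finset.prod_mul_distrib, Finset.prod_pow, ← hprod, Finset.prod_const, Finset.card_univ,
      AlgHom.card]
  have hle : ∏ σ ∈ Finset.univ.erase σ₀, ‖σ P‖ ≤ ∏ σ ∈ Finset.univ.erase σ₀, C * ‖σ s‖ ^ e :=
    Finset.prod_le_prod (fun _ _ ↦ norm_nonneg _)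
      fun σ hσ ↦ (hother σ (Finset.ne_of_mem_erase hσ)).2
  have hs0 : 0 ≤ C * (s : ℝ) ^ e := by positivity
  have hnn : 0 ≤ ∏ σ ∈ Finset.univ.erase σ₀, ‖σ P‖ := Finset.prod_nonneg fun _ _ ↦ norm_nonneg _
  rw [← hall, ← Finset.mul_prod_erase _ _ (Finset.mem_univ σ₀), hσ₀x, abs_of_pos hs]
  rw [hprod, ← Finset.mul_prod_erase _ _ (Finset.mem_univ σ₀), hσ₀x] at hone
  have hH0 : 0 ≤ H := (abs_nonneg _).trans hH
  calc C * (s : ℝ) ^ e = C * (s : ℝ) ^ e * 1 := (mul_one _).symm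
    _ ≤ C * (s : ℝ) ^ e * (H * ∏ σ ∈ Finset.univ.erase σ₀, C * ‖σ s‖ ^ e) := by
        refine mul_le_mul_of_nonneg_left (hone.trans ?_) hs0
        gcongr
    _ = _ := by ring

theorem le_totient_sq_mul_gcd_two {l : ℕ} (hl : 0 < l) : l ≤ l.totient ^ 2 * Nat.gcd 2 l := by
  induction l using Nat.recOnPosPrimePosCoprime with
  | prime_pow p k hp hk =>
    obtain ⟨k, rfl⟩ := Nat.exists_eq_succ_of_ne_zero hk.ne'
    rw [Nat.succ_eq_add_one, Nat.totient_prime_pow_succ hp]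
    have h1 : 1 ≤ p ^ k := Nat.one_le_pow _ _ hp.pos
    rcases hp.eq_two_or_odd' with rfl | hodd
    · have : Nat.gcd 2 (2 ^ (k + 1)) = 2 := Nat.gcd_eq_left (dvd_pow_self 2 (by omega))
      rw [this, pow_succ]
      simp only [Nat.reduceSub, mul_one]
      nlinarith
    · obtain ⟨j, rfl⟩ := hodd
      have hj : 1 ≤ j := by
        rcases Nat.eq_zero_or_pos j with rfl | h
        · exact absurd hp (by decide)
        · exact h
      have : Nat.gcd 2 ((2 * j + 1) ^ (k + 1)) = 1 :=
        Nat.Coprime.pow_right _ (by simp)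
      rw [this, pow_succ, Nat.add_sub_cancel, mul_one]
      calc (2 * j + 1) ^ k * (2 * j + 1) ≤ ((2 * j + 1) ^ k) ^ 2 * (2 * j) ^ 2 := by
            apply Nat.mul_le_mul <;> nlinarith
        _ = _ := by ring
  | zero => omega
  | one => simp
  | coprime a b ha hb hab iha ihb =>
    rw [Nat.totient_mul hab, Nat.Coprime.gcd_mul _ hab]
    calc a * b ≤ (a.totient ^ 2 * Nat.gcd 2 a) * (b.totient ^ 2 * Nat.gcd 2 b) :=
          Nat.mul_le_mul (iha (by omega)) (ihb (by omega))
      _ = _ := by ring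

theorem le_two_mul_totient_sq {l : ℕ} (hl : 0 < l) : l ≤ 2 * l.totient ^ 2 := by
  have h1 := le_totient_sq_mul_gcd_two hl
  have h2 : Nat.gcd 2 l ≤ 2 := Nat.gcd_le_left l two_pos
  nlinarith [Nat.zero_le (l.totient ^ 2)]

theorem eval_one_cyclotomic_cases {l : ℕ} (hl : 1 < l) :
    eval 1 (cyclotomic l ℤ) = 1 ∨
      IsPrimePow l ∧ eval 1 (cyclotomic l ℤ) = (l.minFac : ℤ) := by
  by_cases h : IsPrimePow l
  · right
    refine ⟨h, ?_⟩
    obtain ⟨p, k, hp, hk, rfl⟩ := (isPrimePow_nat_iff _).1 h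
    have : Fact p.Prime := ⟨hp⟩
    obtain ⟨k, rfl⟩ := Nat.exists_eq_succ_of_ne_zero hk.ne'
    rw [Nat.succ_eq_add_one, eval_one_cyclotomic_prime_pow, hp.pow_minFac (by omega)]
  · left
    refine eval_one_cyclotomic_not_prime_pow fun {p} hp k hpk ↦ h ?_
    refine (isPrimePow_nat_iff _).2 ⟨p, k, hp, ?_, hpk⟩
    rcases Nat.eq_zero_or_pos k with rfl | hk
    · simp at hpk
      omega
    · exact hk

theorem IsPrimePow.le_two_mul_totient {l : ℕ} (h : IsPrimePow l) :
    l ≤ 2 * l.totient ∧ l.minFac ≤ l.totient + 1 := by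
  obtain ⟨p, k, hp, hk, rfl⟩ := (isPrimePow_nat_iff _).1 h
  obtain ⟨k, rfl⟩ := Nat.exists_eq_succ_of_ne_zero hk.ne'
  rw [hp.pow_minFac (by omega), Nat.succ_eq_add_one, Nat.totient_prime_pow_succ hp]
  have h1 : 1 ≤ p ^ k := Nat.one_le_pow _ _ hp.pos
  obtain ⟨q, rfl⟩ : ∃ q, p = q + 2 := ⟨p - 2, by have := hp.two_le; omega⟩
  rw [show q + 2 - 1 = q + 1 by omega, pow_succ]
  constructor <;> nlinarith

theorem not_isPrimePow_six : ¬ IsPrimePow 6 := by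
  intro h
  obtain ⟨p, k, hp, hk, h6⟩ := (isPrimePow_nat_iff _).1 h
  have h2 := (Nat.prime_dvd_prime_iff_eq Nat.prime_two hp).1
    (Nat.prime_two.dvd_of_dvd_pow (h6 ▸ by norm_num : 2 ∣ p ^ k))
  have h3 := (Nat.prime_dvd_prime_iff_eq Nat.prime_three hp).1
    (Nat.prime_three.dvd_of_dvd_pow (h6 ▸ by norm_num : 3 ∣ p ^ k))
  omega

theorem mul_pow_le_of_le {A B D E m m₀ : ℕ} (hA : 0 < A) (hBA : B ≤ A) (hm : m₀ ≤ m)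
    (h : A ^ m * E ≤ D * B ^ m) : A ^ m₀ * E ≤ D * B ^ m₀ := by
  obtain ⟨j, rfl⟩ := Nat.exists_eq_add_of_le hm
  refine Nat.le_of_mul_le_mul_left ?_ (pow_pos hA j)
  calc A ^ j * (A ^ m₀ * E) = A ^ (m₀ + j) * E := by ring
    _ ≤ D * B ^ (m₀ + j) := h
    _ = B ^ j * (D * B ^ m₀) := by ring
    _ ≤ A ^ j * (D * B ^ m₀) := by gcongr

theorem mul_pow_lt_mul_pow_of_le {a b q k D E N₀ N : ℕ} (hN₀ : 0 < N₀) (hN : N₀ ≤ N)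
    (hstep : q * (N₀ + 1) ^ k ≤ a * N₀ ^ k) (h₀ : D * (b * N₀) ^ k * q ^ N₀ < E * a ^ N₀) :
    D * (b * N) ^ k * q ^ N < E * a ^ N := by
  induction N, hN using Nat.le_induction with
  | base => exact h₀
  | succ N hN ih =>
    have h1 : N₀ * (N + 1) ≤ (N₀ + 1) * N := by nlinarith
    have h2 : q * (N + 1) ^ k ≤ a * N ^ k := by
      refine Nat.le_of_mul_le_mul_left ?_ (pow_pos hN₀ k)
      calc N₀ ^ k * (q * (N + 1) ^ k) = q * (N₀ * (N + 1)) ^ k := by rw [mul_pow]; ring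
        _ ≤ q * ((N₀ + 1) * N) ^ k := by gcongr
        _ = q * (N₀ + 1) ^ k * N ^ k := by rw [mul_pow]; ring
        _ ≤ a * N₀ ^ k * N ^ k := by gcongr
        _ = _ := by ring
    have ha : 0 < a := by
      rcases Nat.eq_zero_or_pos a with rfl | h
      · rw [zero_pow (by omega)] at ih; omega
      · exact h
    calc D * (b * (N + 1)) ^ k * q ^ (N + 1) = D * b ^ k * q ^ N * (q * (N + 1) ^ k) := by
          rw [mul_pow]; ring
      _ ≤ D * b ^ k * q ^ N * (a * N ^ k) := by gcongr
      _ = D * (b * N) ^ k * q ^ N * a := by rw [mul_pow]; ring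
      _ < E * a ^ N * a := by gcongr
      _ = _ := by ring

theorem three_pow_mul_le_eight_pow {n : ℕ} (hn : 14 ≤ n) : 3 ^ n * (2 * n + 1) ^ 4 ≤ 8 ^ n := by
  induction n, hn using Nat.le_induction with
  | base => norm_num
  | succ n hn ih =>
    have h : 3 * (2 * (n + 1) + 1) ^ 4 ≤ 8 * (2 * n + 1) ^ 4 := by
      have h1 : 29 * (2 * (n + 1) + 1) ≤ 31 * (2 * n + 1) := by omega
      have h2 := Nat.pow_le_pow_left h1 4
      rw [mul_pow, mul_pow] at h2
      omega
    calc 3 ^ (n + 1) * (2 * (n + 1) + 1) ^ 4 = 3 ^ n * (3 * (2 * (n + 1) + 1) ^ 4) := by ring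
      _ ≤ 3 ^ n * (8 * (2 * n + 1) ^ 4) := by gcongr
      _ = 3 ^ n * (2 * n + 1) ^ 4 * 8 := by ring
      _ ≤ 8 ^ n * 8 := by gcongr
      _ = 8 ^ (n + 1) := by ring

theorem lt_eight_pow_mul_of_totient {l n m : ℕ} (hl : 0 < l) (hφ : l.totient = 2 * n)
    (hN : 100 ≤ n * m) : 14 ^ 20 * l ^ 8 < 8 ^ (n * m) * 4096 := by
  have h1 := le_two_mul_totient_sq hl
  have hm : 0 < m := Nat.pos_of_mul_pos_left (by omega : 0 < n * m)
  have h2 : l ≤ 8 * (n * m) ^ 2 := by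
    rw [hφ] at h1
    have : n ^ 2 ≤ (n * m) ^ 2 := Nat.pow_le_pow_left (Nat.le_mul_of_pos_right n hm) 2
    nlinarith
  have h3 := mul_pow_lt_mul_pow_of_le (a := 8) (b := 1) (q := 1) (k := 16) (D := 14 ^ 20 * 8 ^ 8)
    (E := 4096) (N₀ := 100) (by norm_num) hN (by norm_num) (by norm_num)
  calc 14 ^ 20 * l ^ 8 ≤ 14 ^ 20 * (8 * (n * m) ^ 2) ^ 8 := by gcongr
    _ = 14 ^ 20 * 8 ^ 8 * (1 * (n * m)) ^ 16 * 1 ^ (n * m) := by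
        rw [one_pow, one_mul, mul_pow, ← pow_mul]; ring
    _ < _ := h3
    _ = _ := mul_comm _ _

theorem lt_eight_pow_mul_of_isPrimePow {l n m : ℕ} (hl : 6 ≤ l) (h7 : l ≠ 7) (h11 : l ≠ 11)
    (h13 : l ≠ 13) (hpp : IsPrimePow l) (hφ : l.totient = 2 * n) (hN : 100 ≤ n * m) :
    14 ^ 20 * (l.minFac ^ m) ^ 4 * l ^ 8 < 8 ^ (n * m) * 4096 := by
  obtain ⟨hl4, hp⟩ := hpp.le_two_mul_totient
  rw [hφ] at hl4 hp
  by_contra! hcon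
  have hn0 : 0 < n := Nat.pos_of_mul_pos_right (by omega : 0 < n * m)
  have hm0 : 0 < m := Nat.pos_of_mul_pos_left (by omega : 0 < n * m)
  have key : ∀ B m₀ L, l.minFac ^ 4 ≤ B → l ≤ L → B ≤ 8 ^ n → m₀ ≤ m →
      (8 ^ n) ^ m₀ * 4096 ≤ 14 ^ 20 * L ^ 8 * B ^ m₀ := by
    intro B m₀ L hB hL hB8 hm₀
    refine mul_pow_le_of_le (by positivity) hB8 hm₀ ?_
    rw [← pow_mul]
    calc 8 ^ (n * m) * 4096 ≤ 14 ^ 20 * (l.minFac ^ m) ^ 4 * l ^ 8 := hcon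
      _ = 14 ^ 20 * l ^ 8 * (l.minFac ^ 4) ^ m := by rw [← pow_mul, ← pow_mul, mul_comm m 4]; ring
      _ ≤ _ := by gcongr
  have hpB : l.minFac ^ 4 ≤ (2 * n + 1) ^ 4 := by gcongr
  rcases le_or_gt 14 n with hn | hn
  · have h3 := three_pow_mul_le_eight_pow hn
    have hle : (2 * n + 1) ^ 4 ≤ 8 ^ n := le_trans (Nat.le_mul_of_pos_left _ (by positivity)) h3
    have h := key _ m (4 * n) hpB (by omega) hle le_rfl
    have h4 := mul_pow_lt_mul_pow_of_le (a := 3) (b := 4) (q := 1) (k := 8) (D := 14 ^ 20)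
      (E := 4096) (N₀ := 100) (by norm_num) hN (by norm_num) (by norm_num)
    have h5 : 14 ^ 20 * (4 * n) ^ 8 < 4096 * 3 ^ (n * m) := by
      refine lt_of_le_of_lt ?_ h4
      rw [one_pow, mul_one]
      gcongr
      exact Nat.le_mul_of_pos_right n hm0
    have h6 : 3 ^ (n * m) * ((2 * n + 1) ^ 4) ^ m ≤ (8 ^ n) ^ m := by
      rw [pow_mul, ← mul_pow]
      exact Nat.pow_le_pow_left h3 m
    have h7 : 0 < ((2 * n + 1) ^ 4) ^ m := by positivity
    nlinarith
  · rcases le_or_gt 9 n with hn9 | hn9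
    · interval_cases n
      · exact absurd (key _ 12 _ hpB hl4 (by norm_num) (by omega)) (by norm_num)
      · exact absurd (key _ 10 _ hpB hl4 (by norm_num) (by omega)) (by norm_num)
      · exact absurd (key _ 10 _ hpB hl4 (by norm_num) (by omega)) (by norm_num)
      · exact absurd (key _ 9 _ hpB hl4 (by norm_num) (by omega)) (by norm_num)
      · exact absurd (key _ 8 _ hpB hl4 (by norm_num) (by omega)) (by norm_num)
    · have hl32 : l ≤ 32 := by omega
      have hl6 : l ≠ 6 := by
        rintro rfl
        exact not_isPrimePow_six hpp
      have hm : (100 + n - 1) / n ≤ m := by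
        rw [Nat.div_le_iff_le_mul hn0]
        rw [mul_comm] at hN
        omega
      have h := fun h8 ↦ key _ _ _ le_rfl le_rfl h8 hm
      clear key hcon hpp hpB hl4 hp hm
      interval_cases l <;> first
        | omega
        | interval_cases n <;> first
          | exact absurd hφ (by decide)
          | exact absurd (h (by norm_num)) (by norm_num)

theorem sub_pow_mul_sub_pow_nonneg {a b t : ℝ} (ha : a ≤ t) (hb : t ≤ b) (i j : ℕ) :
    0 ≤ (t - a) ^ i * (b - t) ^ j :=
  mul_nonneg (pow_nonneg (sub_nonneg.2 ha) i) (pow_nonneg (sub_nonneg.2 hb) j)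

theorem abs_quadratic_le {t : ℝ} (h0 : 0 ≤ t) (h1 : t ≤ 961 / 1600) :
    |t * (1 - 2 * t)| ≤ 1 / 8 := by
  rw [abs_le]
  constructor
  · nlinarith
  · nlinarith [sq_nonneg (4 * t - 1)]

theorem abs_sextic_le {t : ℝ} (h0 : 0 ≤ t) (h1 : t ≤ 961 / 1600) :
    |t * (t ^ 5 - t ^ 4 + 3 / 11 * t ^ 2 - 1 / 11 * t + 1 / 121)| ≤ 1 / 2500 := by
  have key : ∀ a b : ℝ, a ≤ t → t ≤ b → (a = 0 ∧ b = 6 / 25 ∨ a = 6 / 25 ∧ b = 14 / 25 ∨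
      a = 14 / 25 ∧ b = 961 / 1600) →
      |t * (t ^ 5 - t ^ 4 + 3 / 11 * t ^ 2 - 1 / 11 * t + 1 / 121)| ≤ 1 / 2500 := by
    intro a b ha hb hab
    have B := sub_pow_mul_sub_pow_nonneg ha hb
    have B0 := B 0 6
    have B1 := B 1 5
    have B2 := B 2 4
    have B3 := B 3 3
    have B4 := B 4 2
    have B5 := B 5 1
    have B6 := B 6 0
    rw [abs_le]
    obtain ⟨rfl, rfl⟩ | ⟨rfl, rfl⟩ | ⟨rfl, rfl⟩ := hab <;> constructor <;> linarith
  rcases le_total t (6 / 25) with h | h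
  · exact key _ _ h0 h (by simp)
  rcases le_total t (14 / 25) with h' | h'
  · exact key _ _ h h' (by simp)
  · exact key _ _ h' h1 (by simp)

theorem abs_septic_le {t : ℝ} (h0 : 0 ≤ t) (h1 : t ≤ 961 / 1600) :
    |t * (t ^ 6 - 2 * t ^ 5 + t ^ 4 + 3 / 13 * t ^ 3 - 4 / 13 * t ^ 2 + 1 / 13 * t - 1 / 169)| ≤
      1 / 4500 := by
  have key : ∀ a b : ℝ, a ≤ t → t ≤ b → (a = 0 ∧ b = 13 / 50 ∨ a = 13 / 50 ∧ b = 13 / 25 ∨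
      a = 13 / 25 ∧ b = 961 / 1600) →
      |t * (t ^ 6 - 2 * t ^ 5 + t ^ 4 + 3 / 13 * t ^ 3 - 4 / 13 * t ^ 2 + 1 / 13 * t - 1 / 169)| ≤
        1 / 4500 := by
    intro a b ha hb hab
    have B := sub_pow_mul_sub_pow_nonneg ha hb
    have B0 := B 0 7
    have B1 := B 1 6
    have B2 := B 2 5
    have B3 := B 3 4
    have B4 := B 4 3
    have B5 := B 5 2
    have B6 := B 6 1
    have B7 := B 7 0
    rw [abs_le]
    obtain ⟨rfl, rfl⟩ | ⟨rfl, rfl⟩ | ⟨rfl, rfl⟩ := hab <;> constructor <;> linarith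
  rcases le_total t (13 / 50) with h | h
  · exact key _ _ h0 h (by simp)
  rcases le_total t (13 / 25) with h' | h'
  · exact key _ _ h h' (by simp)
  · exact key _ _ h' h1 (by simp)

theorem mul_cubic_sq_le {t : ℝ} (h0 : 0 ≤ t) (h1 : t ≤ 57 / 100) :
    t * (49 * t ^ 3 - 49 * t ^ 2 + 14 * t - 1) ^ 2 ≤ 13 / 1000 := by
  have key : ∀ a b : ℝ, a ≤ t → t ≤ b → (a = 0 ∧ b = 1 / 25 ∨ a = 1 / 25 ∧ b = 6 / 25 ∨
      a = 6 / 25 ∧ b = 23 / 50 ∨ a = 23 / 50 ∧ b = 57 / 100) →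
      t * (49 * t ^ 3 - 49 * t ^ 2 + 14 * t - 1) ^ 2 ≤ 13 / 1000 := by
    intro a b ha hb hab
    have B := sub_pow_mul_sub_pow_nonneg ha hb
    have B0 := B 0 7
    have B1 := B 1 6
    have B2 := B 2 5
    have B3 := B 3 4
    have B4 := B 4 3
    have B5 := B 5 2
    have B6 := B 6 1
    have B7 := B 7 0
    obtain ⟨rfl, rfl⟩ | ⟨rfl, rfl⟩ | ⟨rfl, rfl⟩ | ⟨rfl, rfl⟩ := hab <;> linarith
  rcases le_total t (1 / 25) with h | h
  · exact key _ _ h0 h (by simp)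
  rcases le_total t (6 / 25) with h' | h'
  · exact key _ _ h h' (by simp)
  rcases le_total t (23 / 50) with h'' | h''
  · exact key _ _ h' h'' (by simp)
  · exact key _ _ h'' h1 (by simp)

theorem mul_cubic_sq_le_of_le {t b : ℝ} (h0 : 57 / 100 ≤ t) (hb : t ≤ b) :
    t * (49 * t ^ 3 - 49 * t ^ 2 + 14 * t - 1) ^ 2 ≤
      b * (49 * b ^ 3 - 49 * b ^ 2 + 14 * b - 1) ^ 2 := by
  have h1 : 0 ≤ 49 * t ^ 3 - 49 * t ^ 2 + 14 * t - 1 := by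
    nlinarith [mul_nonneg (sub_nonneg.2 h0) (sq_nonneg (t - 43 / 200)), sq_nonneg (t - 57 / 100)]
  have h2 : 49 * t ^ 3 - 49 * t ^ 2 + 14 * t - 1 ≤ 49 * b ^ 3 - 49 * b ^ 2 + 14 * b - 1 := by
    have : 0 ≤ 49 * (b ^ 2 + b * t + t ^ 2) - 49 * (b + t) + 14 := by nlinarith
    nlinarith [mul_nonneg (sub_nonneg.2 hb) this]
  have h3 : (0 : ℝ) ≤ t := by linarith
  have h4 : (0 : ℝ) ≤ b := h3.trans hb
  gcongr

theorem abs_cube_mul_linear_le {t : ℝ} (h0 : 0 ≤ t) (h1 : t ≤ 961 / 1600) :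
    |(t * (49 * t ^ 3 - 49 * t ^ 2 + 14 * t - 1) ^ 2) ^ 3 * (5 * t - 3)| ≤ 69 / 10 ^ 7 := by
  have key : ∀ W Z : ℝ, t * (49 * t ^ 3 - 49 * t ^ 2 + 14 * t - 1) ^ 2 ≤ W → |5 * t - 3| ≤ Z →
      W ^ 3 * Z ≤ 69 / 10 ^ 7 →
      |(t * (49 * t ^ 3 - 49 * t ^ 2 + 14 * t - 1) ^ 2) ^ 3 * (5 * t - 3)| ≤ 69 / 10 ^ 7 := by
    intro W Z hW hZ hWZ
    have hw : 0 ≤ t * (49 * t ^ 3 - 49 * t ^ 2 + 14 * t - 1) ^ 2 := by positivity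
    rw [abs_mul, abs_of_nonneg (pow_nonneg hw 3)]
    have hW0 : 0 ≤ W := hw.trans hW
    refine le_trans ?_ hWZ
    gcongr
  rcases le_total t (57 / 100) with h | h
  · exact key _ 3 (mul_cubic_sq_le h0 h) (abs_le.2 ⟨by linarith, by linarith⟩) (by norm_num)
  have step : ∀ a b : ℝ, a ≤ t → t ≤ b → (a = 57 / 100 ∧ b = 117 / 200 ∨
      a = 117 / 200 ∧ b = 59 / 100 ∨ a = 59 / 100 ∧ b = 237 / 400 ∨ a = 237 / 400 ∧ b = 119 / 200 ∨
      a = 119 / 200 ∧ b = 299 / 500) →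
      |(t * (49 * t ^ 3 - 49 * t ^ 2 + 14 * t - 1) ^ 2) ^ 3 * (5 * t - 3)| ≤ 69 / 10 ^ 7 := by
    intro a b ha hb hab
    refine key _ (3 - 5 * a) (mul_cubic_sq_le_of_le h hb) ?_ ?_
    · rw [abs_of_nonpos] <;>
        obtain ⟨rfl, rfl⟩ | ⟨rfl, rfl⟩ | ⟨rfl, rfl⟩ | ⟨rfl, rfl⟩ | ⟨rfl, rfl⟩ := hab <;> linarith
    · obtain ⟨rfl, rfl⟩ | ⟨rfl, rfl⟩ | ⟨rfl, rfl⟩ | ⟨rfl, rfl⟩ | ⟨rfl, rfl⟩ := hab <;> norm_num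
  rcases le_total t (117 / 200) with h2 | h2
  · exact step _ _ h h2 (by simp)
  rcases le_total t (59 / 100) with h3 | h3
  · exact step _ _ h2 h3 (by simp)
  rcases le_total t (237 / 400) with h4 | h4
  · exact step _ _ h3 h4 (by simp)
  rcases le_total t (119 / 200) with h5 | h5
  · exact step _ _ h4 h5 (by simp)
  rcases le_total t (299 / 500) with h6 | h6
  · exact step _ _ h5 h6 (by simp)
  · exact key _ (1 / 100) (mul_cubic_sq_le_of_le h h1)
      (abs_le.2 ⟨by linarith, by linarith⟩) (by norm_num)

theorem exists_geom_sum_eq_zero {l : ℕ} (hl : 1 < l) :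
    ∃ z : ℂ, z ≠ 0 ∧ IsIntegral ℤ z ∧ IsIntegral ℤ z⁻¹ ∧ ∑ i ∈ Finset.range l, z ^ i = 0 ∧
      ((2 - 2 * Real.cos (2 * Real.pi / l) : ℝ) : ℂ) = 2 - z - z⁻¹ := by
  have hζ := Complex.isPrimitiveRoot_exp l (by omega)
  refine ⟨_, hζ.ne_zero (by omega), hζ.isIntegral (by omega), hζ.inv.isIntegral (by omega),
    hζ.geom_sum_eq_zero hl, ?_⟩
  rw [← Complex.exp_neg]
  push_cast
  rw [Complex.two_cos, show (2 * Real.pi / l * Complex.I : ℂ) = 2 * Real.pi * Complex.I / l by ring,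
    show (-(2 * Real.pi / l) * Complex.I : ℂ) = -(2 * Real.pi * Complex.I / l) by ring]
  ring

theorem isIntegral_two_sub_two_cos {l : ℕ} (hl : 1 < l) :
    IsIntegral ℤ (2 - 2 * Real.cos (2 * Real.pi / l)) := by
  obtain ⟨z, -, h1, h2, -, h⟩ := exists_geom_sum_eq_zero hl
  have h3 : IsIntegral ℤ (algebraMap ℝ ℂ (2 - 2 * Real.cos (2 * Real.pi / l))) := by
    rw [Complex.coe_algebraMap, h]
    exact ((isIntegral_ofNat 2).sub h1).sub h2
  exact (isIntegral_algebraMap_iff (algebraMap ℝ ℂ).injective).1 h3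

theorem two_sub_two_cos_pow_seven {s : ℝ} (hs : s = 2 - 2 * Real.cos (2 * Real.pi / (7 : ℕ))) :
    s ^ 3 = 7 * (s - 1) ^ 2 := by
  obtain ⟨z, hz, -, -, hsum, h⟩ := exists_geom_sum_eq_zero (l := 7) (by norm_num)
  rw [← hs] at h
  simp only [Finset.sum_range_succ, Finset.sum_range_zero] at hsum
  have : ((s : ℂ) ^ 3 - 7 * (s - 1) ^ 2) * z ^ 3 = 0 := by
    rw [h]
    field_simp
    linear_combination (-1 : ℂ) * hsum
  have h0 := (mul_eq_zero.1 this).resolve_right (pow_ne_zero _ hz)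
  exact_mod_cast sub_eq_zero.1 h0

theorem two_sub_two_cos_pow_eleven {s : ℝ} (hs : s = 2 - 2 * Real.cos (2 * Real.pi / (11 : ℕ))) :
    s ^ 5 = 11 * (s ^ 4 - 4 * s ^ 3 + 7 * s ^ 2 - 5 * s + 1) := by
  obtain ⟨z, hz, -, -, hsum, h⟩ := exists_geom_sum_eq_zero (l := 11) (by norm_num)
  rw [← hs] at h
  simp only [Finset.sum_range_succ, Finset.sum_range_zero] at hsum
  have : ((s : ℂ) ^ 5 - 11 * (s ^ 4 - 4 * s ^ 3 + 7 * s ^ 2 - 5 * s + 1)) * z ^ 5 = 0 := by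
    rw [h]
    field_simp
    linear_combination (-1 : ℂ) * hsum
  have h0 := (mul_eq_zero.1 this).resolve_right (pow_ne_zero _ hz)
  exact_mod_cast sub_eq_zero.1 h0

theorem two_sub_two_cos_pow_thirteen {s : ℝ}
    (hs : s = 2 - 2 * Real.cos (2 * Real.pi / (13 : ℕ))) :
    s ^ 6 = 13 * (s ^ 5 - 5 * s ^ 4 + 12 * s ^ 3 - 14 * s ^ 2 + 7 * s - 1) := by
  obtain ⟨z, hz, -, -, hsum, h⟩ := exists_geom_sum_eq_zero (l := 13) (by norm_num)
  rw [← hs] at h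
  simp only [Finset.sum_range_succ, Finset.sum_range_zero] at hsum
  have : ((s : ℂ) ^ 6 - 13 * (s ^ 5 - 5 * s ^ 4 + 12 * s ^ 3 - 14 * s ^ 2 + 7 * s - 1)) * z ^ 6 =
      0 := by
    rw [h]
    field_simp
    linear_combination hsum
  have h0 := (mul_eq_zero.1 this).resolve_right (pow_ne_zero _ hz)
  exact_mod_cast sub_eq_zero.1 h0

theorem four_sin_sq_bounds {l : ℕ} (hl : 6 ≤ l) :
    16 / (l : ℝ) ^ 2 ≤ 4 * Real.sin (Real.pi / l) ^ 2 ∧ 4 * Real.sin (Real.pi / l) ^ 2 ≤ 1 := by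
  have hl' : (6 : ℝ) ≤ l := by exact_mod_cast hl
  have hpi := Real.pi_pos
  have h0 : 0 ≤ Real.pi / l := by positivity
  have h6 : Real.pi / l ≤ Real.pi / 6 := by gcongr
  have h1 : 2 / (l : ℝ) ≤ Real.sin (Real.pi / l) := by
    have h := Real.mul_le_sin h0 (by linarith)
    rwa [show 2 / Real.pi * (Real.pi / l) = 2 / (l : ℝ) by field_simp] at h
  have h2 : Real.sin (Real.pi / l) ≤ 1 / 2 := by
    rw [← Real.sin_pi_div_six]
    exact Real.sin_le_sin_of_le_of_le_pi_div_two (by linarith) (by linarith) h6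
  have h3 : 0 < 2 / (l : ℝ) := by positivity
  constructor
  · calc 16 / (l : ℝ) ^ 2 = 4 * (2 / (l : ℝ)) ^ 2 := by ring
      _ ≤ _ := by gcongr
  · nlinarith

theorem mul_pow_le_mul_pow_of_le {C H s s₀ c : ℝ} {e n m m₀ : ℕ} (hC : 0 < C) (hH : 0 ≤ H)
    (hc : 0 ≤ c) (hs₀ : 0 ≤ s₀) (hs : s₀ ≤ s) (hq : C ^ n * c ^ e ≤ 1) (hm : m₀ ≤ m)
    (h : C * s ^ e ≤ H * (C ^ (n * m) * (c ^ m) ^ e)) :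
    C * s₀ ^ e ≤ H * (C ^ n * c ^ e) ^ m₀ :=
  calc C * s₀ ^ e ≤ C * s ^ e := by gcongr
    _ ≤ H * (C ^ (n * m) * (c ^ m) ^ e) := h
    _ = H * (C ^ n * c ^ e) ^ m := by rw [mul_pow, ← pow_mul, ← pow_mul, ← pow_mul, mul_comm m e]
    _ ≤ H * (C ^ n * c ^ e) ^ m₀ :=
        mul_le_mul_of_nonneg_left (pow_le_pow_of_le_one (by positivity) hq hm) hH

/-- Estimate from the auxiliary element `α² (s² - 2 α²)`. -/
theorem norm_bound_generic {K : IntermediateField ℚ ℝ} [FiniteDimensional ℚ K]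
    (htr : ∀ σ : K →+* ℂ, ∀ x : K, (σ x).im = 0) {α s : K} (hα : IsIntegral ℤ α)
    (hs : IsIntegral ℤ s) (hα₁ : 2 ^ 5 < (α : ℝ)) (hα₂ : (α : ℝ) < 14 ^ 5)
    (hs₀ : 0 < (s : ℝ)) (hs₁ : (s : ℝ) ≤ 1)
    (hρ : ∀ ρ : K →+* ℝ, ρ ≠ algebraMap K ℝ →
      0 < ρ s ∧ ∃ t, 0 ≤ t ∧ t ≤ 961 / 1600 ∧ ρ α ^ 2 = t * ρ s ^ 2) :
    1 / 8 * (s : ℝ) ^ 4 ≤ 2 * 14 ^ 20 *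
      ((1 / 8) ^ Module.finrank ℚ K * |((Algebra.norm ℚ s : ℚ) : ℝ)| ^ 4) := by
  have hT1 : (1024 : ℝ) < (α : ℝ) ^ 2 := by nlinarith
  have hT2 : (α : ℝ) ^ 2 < 14 ^ 10 := by nlinarith
  have hs2 : (s : ℝ) ^ 2 ≤ 1 := pow_le_one₀ hs₀.le hs₁
  have hval : ((α ^ 2 * (s ^ 2 - 2 * α ^ 2) : K) : ℝ) =
      (α : ℝ) ^ 2 * ((s : ℝ) ^ 2 - 2 * (α : ℝ) ^ 2) := by
    simp only [← IntermediateField.algebraMap_apply, map_mul, map_sub, map_pow, map_ofNat]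
  have hneg : ((α ^ 2 * (s ^ 2 - 2 * α ^ 2) : K) : ℝ) < 0 := by
    rw [hval]
    nlinarith
  refine le_mul_norm_of_conjugates_le K htr (P := α ^ 2 * (s ^ 2 - 2 * α ^ 2)) ?_ ?_
    (by norm_num) hs₀ ?_ ?_
  · exact (hα.pow 2).mul ((hs.pow 2).sub ((isIntegral_ofNat 2).mul (hα.pow 2)))
  · intro h
    rw [h] at hneg
    simp at hneg
  · rw [abs_of_neg hneg, hval]
    nlinarith [sq_nonneg (s : ℝ)]
  · intro ρ hne
    obtain ⟨h0, t, ht0, ht1, ht⟩ := hρ ρ hne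
    refine ⟨h0, ?_⟩
    have : ρ (α ^ 2 * (s ^ 2 - 2 * α ^ 2)) = t * (1 - 2 * t) * ρ s ^ 4 := by
      simp only [map_mul, map_sub, map_pow, map_ofNat, ht]
      ring
    rw [this, abs_mul, abs_of_pos (pow_pos h0 4)]
    gcongr
    exact abs_quadratic_le ht0 ht1

/-- Sharper estimate for `l = 7`, where `s ^ 3 / 7` is an algebraic integer. -/
theorem norm_bound_seven {K : IntermediateField ℚ ℝ} [FiniteDimensional ℚ K]
    (htr : ∀ σ : K →+* ℂ, ∀ x : K, (σ x).im = 0) {α s v : K} (hα : IsIntegral ℤ α)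
    (hs : IsIntegral ℤ s) (hv : IsIntegral ℤ v) (hα₁ : 2 ^ 5 < (α : ℝ)) (hα₂ : (α : ℝ) < 14 ^ 5)
    (hs₀ : 0 < (s : ℝ)) (hs₁ : (s : ℝ) ≤ 1)
    (hρ : ∀ ρ : K →+* ℝ, ρ ≠ algebraMap K ℝ →
      0 < ρ s ∧ ∃ t, 0 ≤ t ∧ t ≤ 961 / 1600 ∧ ρ α ^ 2 = t * ρ s ^ 2)
    (hsv : s ^ 3 = 7 * v) :
    1 / (2 * 10 ^ 15) * (s : ℝ) ^ 44 ≤ 320 * 14 ^ 220 *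
      ((1 / (2 * 10 ^ 15)) ^ Module.finrank ℚ K * |((Algebra.norm ℚ s : ℚ) : ℝ)| ^ 44) := by
  have hT1 : (1024 : ℝ) < (α : ℝ) ^ 2 := by nlinarith
  have hT2 : (α : ℝ) ^ 2 < 14 ^ 10 := by nlinarith
  have hsv' : (s : ℝ) ^ 3 = 7 * v := by
    have h := congrArg (algebraMap K ℝ) hsv
    simp only [map_mul, map_pow, map_ofNat] at h
    exact h
  have hv0 : 0 < (v : ℝ) := by linarith [pow_pos hs₀ 3]
  have hv1 : (v : ℝ) ≤ 1 := by linarith [pow_le_one₀ hs₀.le hs₁ (n := 3)]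
  set P : K := (α ^ 2) ^ 3 * ((α ^ 2) ^ 3 - s ^ 2 * (α ^ 2) ^ 2 + 2 * v * s * α ^ 2 - v ^ 2) ^ 6 *
    (5 * α ^ 2 - 3 * s ^ 2) with hP
  set T : ℝ := (α : ℝ) ^ 2 with hT
  have hval : (P : ℝ) = T ^ 3 * (T ^ 3 - (s : ℝ) ^ 2 * T ^ 2 + 2 * v * s * T - (v : ℝ) ^ 2) ^ 6 *
      (5 * T - 3 * (s : ℝ) ^ 2) := by
    rw [hP, hT]
    simp only [← IntermediateField.algebraMap_apply, map_mul, map_sub, map_add, map_pow, map_ofNat]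
  have hs2 : (s : ℝ) ^ 2 ≤ 1 := pow_le_one₀ hs₀.le hs₁
  have hv2 : (v : ℝ) ^ 2 ≤ 1 := pow_le_one₀ hv0.le hv1
  have hvs0 : 0 < (v : ℝ) * s := mul_pos hv0 hs₀
  have hvs1 : (v : ℝ) * s ≤ 1 := mul_le_one₀ hv1 hs₀.le hs₁
  have hT0 : 0 < T := by linarith
  have hT22 : 1024 * T ≤ T ^ 2 := by nlinarith
  have hT3 : 1024 * T ^ 2 ≤ T ^ 3 := by nlinarith [pow_pos hT0 2]
  have hC0 : 0 < T ^ 3 - (s : ℝ) ^ 2 * T ^ 2 + 2 * v * s * T - (v : ℝ) ^ 2 := by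
    linarith [mul_le_mul_of_nonneg_right hs2 (sq_nonneg T), mul_nonneg hvs0.le hT0.le]
  have hC1 : T ^ 3 - (s : ℝ) ^ 2 * T ^ 2 + 2 * v * s * T - (v : ℝ) ^ 2 ≤ 2 * T ^ 3 := by
    linarith [mul_nonneg (sq_nonneg (s : ℝ)) (sq_nonneg T), sq_nonneg (v : ℝ),
      mul_le_mul_of_nonneg_right hvs1 hT0.le]
  have hL0 : 0 < 5 * T - 3 * (s : ℝ) ^ 2 := by linarith
  have hL1 : 5 * T - 3 * (s : ℝ) ^ 2 ≤ 5 * T := by linarith [sq_nonneg (s : ℝ)]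
  have hpos : 0 < (P : ℝ) := by
    rw [hval]
    positivity
  refine le_mul_norm_of_conjugates_le K htr (P := P) ?_ ?_ (by norm_num) hs₀ ?_ ?_
  · have hT' := hα.pow 2
    exact ((hT'.pow 3).mul (((((hT'.pow 3).sub ((hs.pow 2).mul (hT'.pow 2))).add
      ((((isIntegral_ofNat 2).mul hv).mul hs).mul hT')).sub (hv.pow 2)).pow 6)).mul
      (((isIntegral_ofNat 5).mul hT').sub ((isIntegral_ofNat 3).mul (hs.pow 2)))
  · intro h
    rw [h] at hpos
    simp at hpos
  · rw [abs_of_pos hpos, hval]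
    calc _ ≤ T ^ 3 * (2 * T ^ 3) ^ 6 * (5 * T) := by gcongr
      _ = 320 * T ^ 22 := by ring
      _ ≤ 320 * (14 ^ 10) ^ 22 := by gcongr
      _ = _ := by ring
  · intro ρ hne
    obtain ⟨h0, t, ht0, ht1, ht⟩ := hρ ρ hne
    refine ⟨h0, ?_⟩
    have hρv : ρ v = ρ s ^ 3 / 7 := by
      rw [← map_pow, hsv, map_mul, map_ofNat]
      ring
    have : ρ P = (t * (49 * t ^ 3 - 49 * t ^ 2 + 14 * t - 1) ^ 2) ^ 3 * (5 * t - 3) / 49 ^ 6 *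
        ρ s ^ 44 := by
      simp only [hP, map_mul, map_sub, map_add, map_pow, map_ofNat, ht, hρv]
      ring
    rw [this, abs_mul, abs_of_pos (pow_pos h0 44), abs_div]
    refine mul_le_mul_of_nonneg_right ?_ (pow_pos h0 44).le
    rw [div_le_iff₀ (by norm_num)]
    exact (abs_cube_mul_linear_le ht0 ht1).trans (by norm_num)

/-- Sharper estimate for `l = 11`, where `s ^ 5 / 11` is an algebraic integer. -/
theorem norm_bound_eleven {K : IntermediateField ℚ ℝ} [FiniteDimensional ℚ K]
    (htr : ∀ σ : K →+* ℂ, ∀ x : K, (σ x).im = 0) {α s v : K} (hα : IsIntegral ℤ α)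
    (hs : IsIntegral ℤ s) (hv : IsIntegral ℤ v) (hα₁ : 2 ^ 5 < (α : ℝ)) (hα₂ : (α : ℝ) < 14 ^ 5)
    (hs₀ : 0 < (s : ℝ)) (hs₁ : (s : ℝ) ≤ 1)
    (hρ : ∀ ρ : K →+* ℝ, ρ ≠ algebraMap K ℝ →
      0 < ρ s ∧ ∃ t, 0 ≤ t ∧ t ≤ 961 / 1600 ∧ ρ α ^ 2 = t * ρ s ^ 2)
    (hsv : s ^ 5 = 11 * v) :
    1 / 2500 * (s : ℝ) ^ 12 ≤ 2 * 14 ^ 60 *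
      ((1 / 2500) ^ Module.finrank ℚ K * |((Algebra.norm ℚ s : ℚ) : ℝ)| ^ 12) := by
  have hT1 : (1024 : ℝ) < (α : ℝ) ^ 2 := by nlinarith
  have hT2 : (α : ℝ) ^ 2 < 14 ^ 10 := by nlinarith
  have hsv' : (s : ℝ) ^ 5 = 11 * v := by
    have h := congrArg (algebraMap K ℝ) hsv
    simp only [map_mul, map_pow, map_ofNat] at h
    exact h
  have hv0 : 0 < (v : ℝ) := by linarith [pow_pos hs₀ 5]
  have hv1 : (v : ℝ) ≤ 1 := by linarith [pow_le_one₀ hs₀.le hs₁ (n := 5)]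
  set P : K := α ^ 2 * ((α ^ 2) ^ 5 - s ^ 2 * (α ^ 2) ^ 4 + 3 * v * s * (α ^ 2) ^ 2 -
    v * s ^ 3 * α ^ 2 + v ^ 2) with hP
  set T : ℝ := (α : ℝ) ^ 2 with hT
  have hval : (P : ℝ) = T * (T ^ 5 - (s : ℝ) ^ 2 * T ^ 4 + 3 * v * s * T ^ 2 -
      v * (s : ℝ) ^ 3 * T + (v : ℝ) ^ 2) := by
    rw [hP, hT]
    simp only [← IntermediateField.algebraMap_apply, map_mul, map_sub, map_add, map_pow, map_ofNat]
  have hs2 : (s : ℝ) ^ 2 ≤ 1 := pow_le_one₀ hs₀.le hs₁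
  have hv2 : (v : ℝ) ^ 2 ≤ 1 := pow_le_one₀ hv0.le hv1
  have hvs0 : 0 < (v : ℝ) * s := mul_pos hv0 hs₀
  have hvs1 : (v : ℝ) * s ≤ 1 := mul_le_one₀ hv1 hs₀.le hs₁
  have hvs3 : (v : ℝ) * s ^ 3 ≤ 1 := mul_le_one₀ hv1 (by positivity) (pow_le_one₀ hs₀.le hs₁)
  have hT0 : 0 < T := by linarith
  have hT22 : 1024 * T ≤ T ^ 2 := by nlinarith
  have hT4 : 1024 * T ^ 2 ≤ T ^ 4 := by nlinarith
  have hT5 : 1024 * T ^ 4 ≤ T ^ 5 := by nlinarith [pow_pos hT0 4]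
  have hQ0 : 0 < T ^ 5 - (s : ℝ) ^ 2 * T ^ 4 + 3 * v * s * T ^ 2 -
      v * (s : ℝ) ^ 3 * T + (v : ℝ) ^ 2 := by
    linarith [mul_le_mul_of_nonneg_right hs2 (pow_nonneg hT0.le 4), sq_nonneg (v : ℝ),
      mul_le_mul_of_nonneg_right hvs3 hT0.le, mul_nonneg hvs0.le (sq_nonneg T)]
  have hQ1 : T ^ 5 - (s : ℝ) ^ 2 * T ^ 4 + 3 * v * s * T ^ 2 -
      v * (s : ℝ) ^ 3 * T + (v : ℝ) ^ 2 ≤ 2 * T ^ 5 := by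
    linarith [mul_nonneg (sq_nonneg (s : ℝ)) (pow_nonneg hT0.le 4),
      mul_nonneg (mul_nonneg hv0.le (pow_nonneg hs₀.le 3)) hT0.le,
      mul_le_mul_of_nonneg_right hvs1 (sq_nonneg T)]
  have hpos : 0 < (P : ℝ) := by
    rw [hval]
    positivity
  refine le_mul_norm_of_conjugates_le K htr (P := P) ?_ ?_ (by norm_num) hs₀ ?_ ?_
  · have hT' := hα.pow 2
    exact hT'.mul (((((hT'.pow 5).sub ((hs.pow 2).mul (hT'.pow 4))).add
      ((((isIntegral_ofNat 3).mul hv).mul hs).mul (hT'.pow 2))).sub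
      ((hv.mul (hs.pow 3)).mul hT')).add (hv.pow 2))
  · intro h
    rw [h] at hpos
    simp at hpos
  · rw [abs_of_pos hpos, hval]
    calc _ ≤ T * (2 * T ^ 5) := by gcongr
      _ = 2 * T ^ 6 := by ring
      _ ≤ 2 * (14 ^ 10) ^ 6 := by gcongr
      _ = _ := by ring
  · intro ρ hne
    obtain ⟨h0, t, ht0, ht1, ht⟩ := hρ ρ hne
    refine ⟨h0, ?_⟩
    have hρv : ρ v = ρ s ^ 5 / 11 := by
      rw [← map_pow, hsv, map_mul, map_ofNat]
      ring
    have : ρ P = t * (t ^ 5 - t ^ 4 + 3 / 11 * t ^ 2 - 1 / 11 * t + 1 / 121) * ρ s ^ 12 := by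
      simp only [hP, map_mul, map_sub, map_add, map_pow, map_ofNat, ht, hρv]
      ring
    rw [this, abs_mul, abs_of_pos (pow_pos h0 12)]
    gcongr
    exact abs_sextic_le ht0 ht1

/-- Sharper estimate for `l = 13`, where `s ^ 6 / 13` is an algebraic integer. -/
theorem norm_bound_thirteen {K : IntermediateField ℚ ℝ} [FiniteDimensional ℚ K]
    (htr : ∀ σ : K →+* ℂ, ∀ x : K, (σ x).im = 0) {α s v : K} (hα : IsIntegral ℤ α)
    (hs : IsIntegral ℤ s) (hv : IsIntegral ℤ v) (hα₁ : 2 ^ 5 < (α : ℝ)) (hα₂ : (α : ℝ) < 14 ^ 5)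
    (hs₀ : 0 < (s : ℝ)) (hs₁ : (s : ℝ) ≤ 1)
    (hρ : ∀ ρ : K →+* ℝ, ρ ≠ algebraMap K ℝ →
      0 < ρ s ∧ ∃ t, 0 ≤ t ∧ t ≤ 961 / 1600 ∧ ρ α ^ 2 = t * ρ s ^ 2)
    (hsv : s ^ 6 = 13 * v) :
    1 / 4500 * (s : ℝ) ^ 14 ≤ 2 * 14 ^ 70 *
      ((1 / 4500) ^ Module.finrank ℚ K * |((Algebra.norm ℚ s : ℚ) : ℝ)| ^ 14) := by
  have hT1 : (1024 : ℝ) < (α : ℝ) ^ 2 := by nlinarith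
  have hT2 : (α : ℝ) ^ 2 < 14 ^ 10 := by nlinarith
  have hsv' : (s : ℝ) ^ 6 = 13 * v := by
    have h := congrArg (algebraMap K ℝ) hsv
    simp only [map_mul, map_pow, map_ofNat] at h
    exact h
  have hv0 : 0 < (v : ℝ) := by linarith [pow_pos hs₀ 6]
  have hv1 : (v : ℝ) ≤ 1 := by linarith [pow_le_one₀ hs₀.le hs₁ (n := 6)]
  set P : K := α ^ 2 * ((α ^ 2) ^ 6 - 2 * s ^ 2 * (α ^ 2) ^ 5 + s ^ 4 * (α ^ 2) ^ 4 +
    3 * v * (α ^ 2) ^ 3 - 4 * v * s ^ 2 * (α ^ 2) ^ 2 + v * s ^ 4 * α ^ 2 - v ^ 2) with hP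
  set T : ℝ := (α : ℝ) ^ 2 with hT
  have hval : (P : ℝ) = T * (T ^ 6 - 2 * (s : ℝ) ^ 2 * T ^ 5 + (s : ℝ) ^ 4 * T ^ 4 +
      3 * v * T ^ 3 - 4 * v * (s : ℝ) ^ 2 * T ^ 2 + v * (s : ℝ) ^ 4 * T - (v : ℝ) ^ 2) := by
    rw [hP, hT]
    simp only [← IntermediateField.algebraMap_apply, map_mul, map_sub, map_add, map_pow, map_ofNat]
  have hs2 : (s : ℝ) ^ 2 ≤ 1 := pow_le_one₀ hs₀.le hs₁
  have hs4 : (s : ℝ) ^ 4 ≤ 1 := pow_le_one₀ hs₀.le hs₁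
  have hv2 : (v : ℝ) ^ 2 ≤ 1 := pow_le_one₀ hv0.le hv1
  have hvs2 : (v : ℝ) * s ^ 2 ≤ 1 := mul_le_one₀ hv1 (by positivity) hs2
  have hvs4 : (v : ℝ) * s ^ 4 ≤ 1 := mul_le_one₀ hv1 (by positivity) hs4
  have hT0 : 0 < T := by linarith
  have hT22 : 1024 * T ≤ T ^ 2 := by nlinarith
  have hT3 : 1024 * T ^ 2 ≤ T ^ 3 := by nlinarith [pow_pos hT0 2]
  have hT4 : 1024 * T ^ 3 ≤ T ^ 4 := by nlinarith [pow_pos hT0 3]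
  have hT5 : 1024 * T ^ 4 ≤ T ^ 5 := by nlinarith [pow_pos hT0 4]
  have hT6 : 1024 * T ^ 5 ≤ T ^ 6 := by nlinarith [pow_pos hT0 5]
  have hQ0 : 0 < T ^ 6 - 2 * (s : ℝ) ^ 2 * T ^ 5 + (s : ℝ) ^ 4 * T ^ 4 +
      3 * v * T ^ 3 - 4 * v * (s : ℝ) ^ 2 * T ^ 2 + v * (s : ℝ) ^ 4 * T - (v : ℝ) ^ 2 := by
    linarith [mul_le_mul_of_nonneg_right hs2 (pow_nonneg hT0.le 5),
      mul_nonneg (pow_nonneg hs₀.le 4) (pow_nonneg hT0.le 4),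
      mul_nonneg hv0.le (pow_nonneg hT0.le 3),
      mul_le_mul_of_nonneg_right hvs2 (pow_nonneg hT0.le 2),
      mul_nonneg (mul_nonneg hv0.le (pow_nonneg hs₀.le 4)) hT0.le]
  have hQ1 : T ^ 6 - 2 * (s : ℝ) ^ 2 * T ^ 5 + (s : ℝ) ^ 4 * T ^ 4 + 3 * v * T ^ 3 -
      4 * v * (s : ℝ) ^ 2 * T ^ 2 + v * (s : ℝ) ^ 4 * T - (v : ℝ) ^ 2 ≤ 2 * T ^ 6 := by
    linarith [mul_nonneg (sq_nonneg (s : ℝ)) (pow_nonneg hT0.le 5),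
      mul_le_mul_of_nonneg_right hs4 (pow_nonneg hT0.le 4),
      mul_le_mul_of_nonneg_right hv1 (pow_nonneg hT0.le 3),
      mul_nonneg (mul_nonneg hv0.le (sq_nonneg (s : ℝ))) (sq_nonneg T),
      mul_le_mul_of_nonneg_right hvs4 hT0.le, sq_nonneg (v : ℝ)]
  have hpos : 0 < (P : ℝ) := by
    rw [hval]
    positivity
  refine le_mul_norm_of_conjugates_le K htr (P := P) ?_ ?_ (by norm_num) hs₀ ?_ ?_
  · have hT' := hα.pow 2
    exact hT'.mul (((((((hT'.pow 6).sub (((isIntegral_ofNat 2).mul (hs.pow 2)).mul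
      (hT'.pow 5))).add ((hs.pow 4).mul (hT'.pow 4))).add
      (((isIntegral_ofNat 3).mul hv).mul (hT'.pow 3))).sub
      ((((isIntegral_ofNat 4).mul hv).mul (hs.pow 2)).mul (hT'.pow 2))).add
      ((hv.mul (hs.pow 4)).mul hT')).sub (hv.pow 2))
  · intro h
    rw [h] at hpos
    simp at hpos
  · rw [abs_of_pos hpos, hval]
    calc _ ≤ T * (2 * T ^ 6) := by gcongr
      _ = 2 * T ^ 7 := by ring
      _ ≤ 2 * (14 ^ 10) ^ 7 := by gcongr
      _ = _ := by ring
  · intro ρ hne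
    obtain ⟨h0, t, ht0, ht1, ht⟩ := hρ ρ hne
    refine ⟨h0, ?_⟩
    have hρv : ρ v = ρ s ^ 6 / 13 := by
      rw [← map_pow, hsv, map_mul, map_ofNat]
      ring
    have : ρ P = t * (t ^ 6 - 2 * t ^ 5 + t ^ 4 + 3 / 13 * t ^ 3 - 4 / 13 * t ^ 2 + 1 / 13 * t -
        1 / 169) * ρ s ^ 14 := by
      simp only [hP, map_mul, map_sub, map_add, map_pow, map_ofNat, ht, hρv]
      ring
    rw [this, abs_mul, abs_of_pos (pow_pos h0 14)]
    gcongr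
    exact abs_septic_le ht0 ht1

/-- **Degree bound for the graphs `Γ₄⁽⁶⁾(14)` with `l ≥ 6`.** Let `l ≥ 6` be an
integer and `K = ℚ(α)` a totally real number field (realized inside `ℝ`) containing
`ℚ(cos(2π/l))`, where `α` is an algebraic integer such that for every real embedding
`σ ≠ id`, `-3.1 σ(sin²(π/l)) < σ(α) < 3.1 σ(sin²(π/l))`, while `2⁵ < α < 14⁵`.
Then `[K : ℚ] ≤ 99`. -/
theorem degree_bound_pentagon_99
    (l : ℕ) (hl : 6 ≤ l)
    (K : IntermediateField ℚ ℝ) [FiniteDimensional ℚ K]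
    (hKtotreal : ∀ σ : K →+* ℂ, ∀ x : K, (σ x).im = 0)
    (hcos : Real.cos (2 * Real.pi / l) ∈ K)
    (α : K) (hαint : IsIntegral ℤ (α : ℝ))
    (hKα : K = IntermediateField.adjoin ℚ {(α : ℝ)})
    (sl : K) (hsl : (sl : ℝ) = Real.sin (Real.pi / l) ^ 2)
    (hσ : ∀ σ : K →+* ℝ, σ ≠ algebraMap K ℝ →
      -3.1 * σ sl < σ α ∧ σ α < 3.1 * σ sl)
    (hgeo : 2 ^ 5 < (α : ℝ) ∧ (α : ℝ) < 14 ^ 5) :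
    Module.finrank ℚ K ≤ 99 := by
  by_contra! hN
  set s : K := 4 * sl with hsdef
  have hs4 : (s : ℝ) = 4 * Real.sin (Real.pi / l) ^ 2 := by
    rw [← hsl, hsdef]
    simp only [← IntermediateField.algebraMap_apply, map_mul, map_ofNat]
  have hscos : (s : ℝ) = 2 - 2 * Real.cos (2 * Real.pi / l) := by
    rw [hs4, mul_div_assoc, Real.cos_two_mul', Real.cos_sq']
    ring
  have hK : Function.Injective (algebraMap K ℝ) := (algebraMap K ℝ).injective
  have hα : IsIntegral ℤ α := (isIntegral_algebraMap_iff hK).1 hαint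
  have hs : IsIntegral ℤ s := by
    refine (isIntegral_algebraMap_iff hK).1 ?_
    rw [IntermediateField.algebraMap_apply, hscos]
    exact isIntegral_two_sub_two_cos (by omega)
  obtain ⟨hsl₀, hs₁⟩ := four_sin_sq_bounds hl
  rw [← hs4] at hsl₀ hs₁
  have hl0 : (0 : ℝ) < l := by exact_mod_cast (by omega : 0 < l)
  have hs₀ : 0 < (s : ℝ) := lt_of_lt_of_le (by positivity) hsl₀
  have hρ : ∀ ρ : K →+* ℝ, ρ ≠ algebraMap K ℝ →
      0 < ρ s ∧ ∃ t, 0 ≤ t ∧ t ≤ 961 / 1600 ∧ ρ α ^ 2 = t * ρ s ^ 2 := by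
    intro ρ hne
    obtain ⟨h1, h2⟩ := hσ ρ hne
    have hρs : ρ s = 4 * ρ sl := by rw [hsdef, map_mul, map_ofNat]
    have hpos : 0 < ρ s := by linarith
    refine ⟨hpos, (ρ α / ρ s) ^ 2, sq_nonneg _, ?_, by field_simp⟩
    rw [div_pow, div_le_iff₀ (by positivity)]
    nlinarith
  obtain ⟨m, hm, hnorm⟩ := norm_two_sub_two_cos K (by omega) hscos
  obtain ⟨n, hn⟩ := Nat.totient_even (n := l) (by omega)
  rw [← two_mul] at hn
  have hNnm : Module.finrank ℚ K = n * m := by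
    rw [hn, mul_assoc] at hm
    omega
  have hnm : 100 ≤ n * m := by omega
  obtain ⟨c, hc, hcases⟩ : ∃ c : ℕ, eval 1 (cyclotomic l ℤ) = (c : ℤ) ∧
      (c = 1 ∨ IsPrimePow l ∧ c = l.minFac) := by
    rcases eval_one_cyclotomic_cases (l := l) (by omega) with h | ⟨h1, h2⟩
    · exact ⟨1, by simpa using h, Or.inl rfl⟩
    · exact ⟨_, h2, Or.inr ⟨h1, rfl⟩⟩
  have habs : |((Algebra.norm ℚ s : ℚ) : ℝ)| = (c : ℝ) ^ m := by
    rw [hnorm, hc]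
    push_cast
    exact abs_of_nonneg (by positivity)
  have hprime : l.Prime → c = l := by
    intro hp
    have : Fact l.Prime := ⟨hp⟩
    rw [eval_one_cyclotomic_prime] at hc
    exact_mod_cast hc.symm
  by_cases h7 : l = 7
  · subst h7
    have hrel : s ^ 3 = 7 * (s - 1) ^ 2 := hK (by
      simpa only [← IntermediateField.algebraMap_apply, map_mul, map_sub, map_pow, map_one,
        map_ofNat] using
        two_sub_two_cos_pow_seven hscos)
    have h := norm_bound_seven hKtotreal hα hs ((hs.sub isIntegral_one).pow 2) hgeo.1 hgeo.2 hs₀ hs₁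
      hρ hrel
    have hn3 : n = 3 := by
      rw [Nat.totient_prime (by norm_num)] at hn
      omega
    rw [habs, hNnm, hprime (by norm_num), hn3] at h
    exact absurd (mul_pow_le_mul_pow_of_le (m₀ := 34) (by norm_num) (by positivity) (by norm_num)
      (by positivity) hsl₀ (by norm_num) (by subst hn3; omega) h) (by norm_num)
  by_cases h11 : l = 11
  · subst h11
    have hrel : s ^ 5 = 11 * (s ^ 4 - 4 * s ^ 3 + 7 * s ^ 2 - 5 * s + 1) := hK (by
      simpa only [← IntermediateField.algebraMap_apply, map_mul, map_sub, map_add, map_pow,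
        map_one, map_ofNat] using
        two_sub_two_cos_pow_eleven hscos)
    have hv : IsIntegral ℤ (s ^ 4 - 4 * s ^ 3 + 7 * s ^ 2 - 5 * s + 1) :=
      (((((hs.pow 4).sub ((isIntegral_ofNat 4).mul (hs.pow 3))).add
        ((isIntegral_ofNat 7).mul (hs.pow 2))).sub ((isIntegral_ofNat 5).mul hs)).add
        isIntegral_one)
    have h := norm_bound_eleven hKtotreal hα hs hv hgeo.1 hgeo.2 hs₀ hs₁ hρ hrel
    have hn5 : n = 5 := by
      rw [Nat.totient_prime (by norm_num)] at hn
      omega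
    rw [habs, hNnm, hprime (by norm_num), hn5] at h
    exact absurd (mul_pow_le_mul_pow_of_le (m₀ := 20) (by norm_num) (by positivity) (by norm_num)
      (by positivity) hsl₀ (by norm_num) (by subst hn5; omega) h) (by norm_num)
  by_cases h13 : l = 13
  · subst h13
    have hrel : s ^ 6 = 13 * (s ^ 5 - 5 * s ^ 4 + 12 * s ^ 3 - 14 * s ^ 2 + 7 * s - 1) := hK (by
      simpa only [← IntermediateField.algebraMap_apply, map_mul, map_sub, map_add, map_pow,
        map_one, map_ofNat] using
        two_sub_two_cos_pow_thirteen hscos)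
    have hv : IsIntegral ℤ (s ^ 5 - 5 * s ^ 4 + 12 * s ^ 3 - 14 * s ^ 2 + 7 * s - 1) :=
      ((((((hs.pow 5).sub ((isIntegral_ofNat 5).mul (hs.pow 4))).add
        ((isIntegral_ofNat 12).mul (hs.pow 3))).sub ((isIntegral_ofNat 14).mul (hs.pow 2))).add
        ((isIntegral_ofNat 7).mul hs)).sub isIntegral_one)
    have h := norm_bound_thirteen hKtotreal hα hs hv hgeo.1 hgeo.2 hs₀ hs₁ hρ hrel
    have hn6 : n = 6 := by
      rw [Nat.totient_prime (by norm_num)] at hn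
      omega
    rw [habs, hNnm, hprime (by norm_num), hn6] at h
    exact absurd (mul_pow_le_mul_pow_of_le (m₀ := 17) (by norm_num) (by positivity) (by norm_num)
      (by positivity) hsl₀ (by norm_num) (by subst hn6; omega) h) (by norm_num)
  have h := norm_bound_generic hKtotreal hα hs hgeo.1 hgeo.2 hs₀ hs₁ hρ
  rw [habs, hNnm] at h
  have hreal : (8 : ℝ) ^ (n * m) * 4096 ≤ 14 ^ 20 * ((c : ℝ) ^ m) ^ 4 * (l : ℝ) ^ 8 := by
    have h1 : 1 / 8 * (16 / (l : ℝ) ^ 2) ^ 4 ≤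
        2 * 14 ^ 20 * ((1 / 8) ^ (n * m) * ((c : ℝ) ^ m) ^ 4) := le_trans (by gcongr) h
    calc (8 : ℝ) ^ (n * m) * 4096
        = 1 / 8 * (16 / (l : ℝ) ^ 2) ^ 4 * (8 ^ (n * m) * (l : ℝ) ^ 8 / 2) := by
          field_simp
          norm_num
      _ ≤ 2 * 14 ^ 20 * ((1 / 8) ^ (n * m) * ((c : ℝ) ^ m) ^ 4) *
          (8 ^ (n * m) * (l : ℝ) ^ 8 / 2) := by gcongr
      _ = 14 ^ 20 * ((c : ℝ) ^ m) ^ 4 * (l : ℝ) ^ 8 := by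
          rw [one_div_pow]
          field_simp
  have hnat : 8 ^ (n * m) * 4096 ≤ 14 ^ 20 * (c ^ m) ^ 4 * l ^ 8 := by exact_mod_cast hreal
  refine absurd hnat (not_le.2 ?_)
  rcases hcases with rfl | ⟨hpp, rfl⟩
  · simpa using lt_eight_pow_mul_of_totient (by omega) hn hnm
  · exact lt_eight_pow_mul_of_isPrimePow hl h7 h11 h13 hpp hn hnm
end

section
/- Let m ∈ {3, 4, 5} and let K be a totally real number field with cos(2π/m) ∈ K and K = ℚ(α), where α is an algebraic integer such that for every real embedding σ : K → ℝ other than the identity, 0 < σ(α) < 4·σ(sin²(π/m)), while 4 < α < 14². Then [K : ℚ] ≤ 76 if m = 3, [K : ℚ] ≤ 31 if m = 4, and [K : ℚ] ≤ 24 if m = 5. -/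
/-- A ring homomorphism to `ℂ` with real image factors through `ℝ`. -/
lemma exists_real_ringHom_of_im_eq_zero {K : Type*} [Semiring K] (σ : K →+* ℂ)
    (h : ∀ x, (σ x).im = 0) : ∃ τ : K →+* ℝ, ∀ x, σ x = (τ x : ℂ) := by
  have hre : ∀ x, σ x = ((σ x).re : ℂ) := fun x => by
    apply Complex.ext <;> simp [h x]
  refine ⟨{ toFun := fun x => (σ x).re, map_one' := by simp, map_zero' := by simp,
            map_add' := fun x y => by simp,
            map_mul' := fun x y => by simp [h x] }, hre⟩

/-- In a totally real field with a distinguished real embedding `ι`, a nonzero integral element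
satisfies `1 ≤ B * c ^ (n - 1)` if its absolute value is at most `B` at `ι`, and at most `c` at the
other real embeddings. -/
lemma one_le_mul_pow_of_isIntegral {K : Type*} [Field K] [Algebra ℚ K] [FiniteDimensional ℚ K]
    (hreal : ∀ σ : K →+* ℂ, ∀ x : K, (σ x).im = 0) (ι : K →+* ℝ) {β : K}
    (hint : IsIntegral ℤ β) (hβ : β ≠ 0) {B c : ℝ} (hB : |ι β| ≤ B)
    (hc : ∀ σ : K →+* ℝ, σ ≠ ι → |σ β| ≤ c) :
    1 ≤ B * c ^ (Module.finrank ℚ K - 1) := by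
  classical
  obtain ⟨z, hz⟩ := IsIntegrallyClosed.isIntegral_iff.mp (Algebra.isIntegral_norm ℚ hint)
  have hz0 : z ≠ 0 := by
    rintro rfl
    exact hβ (Algebra.norm_eq_zero_iff.mp (by rw [← hz, map_zero]))
  have hnorm := Algebra.norm_eq_prod_embeddings ℚ ℂ β
  rw [← hz] at hnorm
  have habs : (1 : ℝ) ≤ ∏ σ : K →ₐ[ℚ] ℂ, ‖σ β‖ := by
    rw [← norm_prod, ← hnorm]
    have : (1 : ℝ) ≤ |(z : ℝ)| := by exact_mod_cast Int.one_le_abs hz0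
    simpa using this
  let σ₀ : K →ₐ[ℚ] ℂ := (Complex.ofRealHom.comp ι).toRatAlgHom
  rw [← Finset.mul_prod_erase Finset.univ _ (Finset.mem_univ σ₀)] at habs
  have hσ₀ : ‖σ₀ β‖ ≤ B := (Complex.norm_real _).trans_le hB
  have hother : ∏ σ ∈ Finset.univ.erase σ₀, ‖σ β‖ ≤ c ^ (Module.finrank ℚ K - 1) := by
    rw [← AlgHom.card ℚ K ℂ, ← Finset.card_univ,
      ← Finset.card_erase_of_mem (Finset.mem_univ σ₀), ← Finset.prod_const]
    refine Finset.prod_le_prod (fun _ _ => norm_nonneg _) fun σ hσ => ?_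
    obtain ⟨τ, hτ⟩ := exists_real_ringHom_of_im_eq_zero (σ : K →+* ℂ) (hreal _)
    have hne : τ ≠ ι := by
      rintro rfl
      exact Finset.ne_of_mem_erase hσ (AlgHom.ext hτ)
    have hβτ : σ β = (τ β : ℂ) := hτ β
    rw [hβτ, Complex.norm_real]
    exact hc τ hne
  exact habs.trans (mul_le_mul hσ₀ hother (Finset.prod_nonneg fun _ _ => norm_nonneg _)
    ((norm_nonneg _).trans hσ₀))

lemma finrank_le_of_isIntegral {K : Type*} [Field K] [Algebra ℚ K] [FiniteDimensional ℚ K]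
    (hreal : ∀ σ : K →+* ℂ, ∀ x : K, (σ x).im = 0) (ι : K →+* ℝ) {β : K}
    (hint : IsIntegral ℤ β) {B c : ℝ} {N : ℕ} (hβ : 0 < ι β) (hB : ι β ≤ B)
    (hc : ∀ σ : K →+* ℝ, σ ≠ ι → |σ β| ≤ c)
    (hc0 : 0 ≤ c) (hc1 : c ≤ 1) (hN : B * c ^ N < 1) :
    Module.finrank ℚ K ≤ N := by
  by_contra! hlt
  have hβ0 : β ≠ 0 := by
    rintro rfl
    simp at hβ
  have h := one_le_mul_pow_of_isIntegral hreal ι hint hβ0 ((abs_of_pos hβ).trans_le hB) hc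
  have hpow : c ^ (Module.finrank ℚ K - 1) ≤ c ^ N :=
    pow_le_pow_of_le_one hc0 hc1 (by omega)
  have := mul_le_mul_of_nonneg_left hpow (hβ.le.trans hB)
  linarith

/-- A product of powers of `x (x - 3)`, `x ^ 2 - 3 x + 1`, `x ^ 2 - 3 x + 2` that is small
on `[0, 3]`. -/
lemma abs_auxiliary_le_of_lt_three {x : ℝ} (h0 : 0 < x) (h3 : x < 3) :
    |(x ^ 2 - 3 * x) ^ 2 * (x ^ 2 - 3 * x + 1) ^ 2 * (x ^ 2 - 3 * x + 2) ^ 3| ≤ 8 / 27 := by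
  obtain ⟨z, hz⟩ : ∃ z, z = x ^ 2 - 3 * x + 1 := ⟨_, rfl⟩
  have hz1 : z ≤ 1 := by nlinarith
  have hz2 : -5 / 4 ≤ z := by nlinarith [sq_nonneg (x - 3 / 2)]
  have hrw : (x ^ 2 - 3 * x) ^ 2 * (x ^ 2 - 3 * x + 1) ^ 2 * (x ^ 2 - 3 * x + 2) ^ 3
      = (z ^ 2 * (1 - z ^ 2) ^ 2) * (1 + z) := by rw [hz]; ring
  rw [hrw, abs_mul, abs_of_nonneg (by positivity)]
  rcases le_total (-1) z with h | h
  · have h1 : z ^ 2 * (1 - z ^ 2) ^ 2 ≤ 4 / 27 := by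
      have : 0 ≤ (z ^ 2 - 1 / 3) ^ 2 * (4 / 3 - z ^ 2) :=
        mul_nonneg (sq_nonneg _) (by nlinarith)
      nlinarith
    have h2 : |1 + z| ≤ 2 := abs_le.mpr ⟨by linarith, by linarith⟩
    calc _ ≤ (4 / 27 : ℝ) * 2 := mul_le_mul h1 h2 (abs_nonneg _) (by norm_num)
      _ = _ := by norm_num
  · have hs1 : 1 ≤ z ^ 2 := by nlinarith
    have hs2 : z ^ 2 ≤ 25 / 16 := by nlinarith
    have h1 : z ^ 2 * (1 - z ^ 2) ^ 2 ≤ 25 / 16 * (81 / 256) :=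
      mul_le_mul hs2 (by nlinarith) (sq_nonneg _) (by norm_num)
    have h2 : |1 + z| ≤ 1 / 4 := abs_le.mpr ⟨by linarith, by linarith⟩
    calc _ ≤ (25 / 16 * (81 / 256) : ℝ) * (1 / 4) :=
          mul_le_mul h1 h2 (abs_nonneg _) (by norm_num)
      _ ≤ _ := by norm_num

lemma abs_auxiliary_le_of_lt_two {x : ℝ} (h0 : 0 < x) (h2 : x < 2) :
    |x * (x - 1) ^ 2 * (x - 2)| ≤ 1 / 4 := by
  rw [abs_le]
  have hs : 0 ≤ x * (2 - x) * (x - 1) ^ 2 :=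
    mul_nonneg (mul_nonneg h0.le (by linarith)) (sq_nonneg _)
  constructor
  · nlinarith [sq_nonneg ((x - 1) ^ 2 - 1 / 2)]
  · nlinarith

/-- For `t` conjugate to `4 sin² (π / 5)`, the factor `(3 - t) ^ 4` is a unit that balances the
maxima on `[0, t]` for the two values of `t`. -/
lemma abs_auxiliary_le_of_sq_eq {t x : ℝ} (ht : t ^ 2 - 5 * t + 5 = 0) (h0 : 0 < x)
    (hx : x < t) :
    |(3 - t) ^ 4 * (x * (x - t) * (x - 1) * (x - t + 1))| ≤ 5 / 16 := by
  obtain ⟨w, hw⟩ : ∃ w, w = x * (t - x) := ⟨_, rfl⟩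
  have hw0 : 0 ≤ w := hw ▸ mul_nonneg h0.le (by linarith)
  have hw1 : w ≤ 5 * (t - 1) / 4 := by nlinarith [sq_nonneg (t - 2 * x)]
  have hu : (3 - t) ^ 4 = 11 - 3 * t := by
    linear_combination (t ^ 2 - 7 * t + 14) * ht
  have hu0 : 0 ≤ 11 - 3 * t := hu ▸ by positivity
  have hrw : (3 - t) ^ 4 * (x * (x - t) * (x - 1) * (x - t + 1))
      = (11 - 3 * t) * (w * (w - (t - 1))) := by
    rw [hu, hw]; ring
  have hmax : (11 - 3 * t) * (5 * (t - 1) ^ 2 / 16) = 5 / 16 := by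
    linear_combination (-15 * t + 10) / 16 * ht
  have hw2 : |w * (w - (t - 1))| ≤ 5 * (t - 1) ^ 2 / 16 := by
    rw [abs_le]
    constructor
    · nlinarith [sq_nonneg (w - (t - 1) / 2), sq_nonneg (t - 1)]
    · nlinarith [mul_nonneg hw0 (sub_nonneg.mpr hw1)]
  rw [hrw, abs_mul, abs_of_nonneg hu0, ← hmax]
  exact mul_le_mul_of_nonneg_left hw2 hu0

lemma four_mul_sin_sq_pi_div_five_eq :
    4 * Real.sin (Real.pi / 5) ^ 2 = (5 - √5) / 2 := by
  have h5 : √5 ^ 2 = 5 := Real.sq_sqrt (by norm_num)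
  rw [Real.sin_sq, Real.cos_pi_div_five]
  linear_combination (-1 / 4) * h5

/-- The degree bound for `m = 3`. -/
lemma finrank_le_of_sin_sq_pi_div_three {K : Type*} [Field K] [Algebra ℚ K] [FiniteDimensional ℚ K]
    (hreal : ∀ σ : K →+* ℂ, ∀ x : K, (σ x).im = 0) (ι : K →+* ℝ) {α s : K}
    (hα : IsIntegral ℤ α) (hs : ι s = Real.sin (Real.pi / 3) ^ 2)
    (hσ : ∀ σ : K →+* ℝ, σ ≠ ι → 0 < σ α ∧ σ α < 4 * σ s)
    (h4 : 4 < ι α) (h196 : ι α < 196) : Module.finrank ℚ K ≤ 76 := by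
  have hs' : s = 3 / 4 := by
    apply ι.injective
    rw [hs, Real.sin_pi_div_three, div_pow, Real.sq_sqrt (by norm_num)]
    norm_num [map_div₀, map_ofNat]
  have h2 : IsIntegral ℤ (2 : K) := isIntegral_natCast 2
  have h3 : IsIntegral ℤ (3 : K) := isIntegral_natCast 3
  have hu : IsIntegral ℤ (α ^ 2 - 3 * α) := (hα.pow 2).sub (h3.mul hα)
  have hu0 : 0 < ι α ^ 2 - 3 * ι α := by nlinarith
  have hu1 : ι α ^ 2 - 3 * ι α ≤ 40000 := by nlinarith
  refine finrank_le_of_isIntegral hreal ι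
    (β := (α ^ 2 - 3 * α) ^ 2 * (α ^ 2 - 3 * α + 1) ^ 2 * (α ^ 2 - 3 * α + 2) ^ 3)
    (B := 40000 ^ 2 * (40000 + 1) ^ 2 * (40000 + 2) ^ 3) (c := 8 / 27)
    (((hu.pow 2).mul ((hu.add isIntegral_one).pow 2)).mul ((hu.add h2).pow 3))
    ?_ ?_ ?_ (by norm_num) (by norm_num) (by norm_num)
  · simp only [map_mul, map_pow, map_sub, map_add, map_ofNat, map_one]
    positivity
  · simp only [map_mul, map_pow, map_sub, map_add, map_ofNat, map_one]
    gcongr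
  · intro σ hne
    obtain ⟨hpos, hlt⟩ := hσ σ hne
    have hσs : σ s = 3 / 4 := by simp [hs', map_ofNat]
    rw [hσs] at hlt
    simpa only [map_mul, map_pow, map_sub, map_add, map_ofNat, map_one] using
      abs_auxiliary_le_of_lt_three hpos (by linarith)

/-- The degree bound for `m = 4`. -/
lemma finrank_le_of_sin_sq_pi_div_four {K : Type*} [Field K] [Algebra ℚ K] [FiniteDimensional ℚ K]
    (hreal : ∀ σ : K →+* ℂ, ∀ x : K, (σ x).im = 0) (ι : K →+* ℝ) {α s : K}
    (hα : IsIntegral ℤ α) (hs : ι s = Real.sin (Real.pi / 4) ^ 2)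
    (hσ : ∀ σ : K →+* ℝ, σ ≠ ι → 0 < σ α ∧ σ α < 4 * σ s)
    (h4 : 4 < ι α) (h196 : ι α < 196) : Module.finrank ℚ K ≤ 31 := by
  have hs' : s = 1 / 2 := by
    apply ι.injective
    rw [hs, Real.sin_pi_div_four, div_pow, Real.sq_sqrt (by norm_num)]
    norm_num [map_div₀, map_ofNat]
  have h2 : IsIntegral ℤ (2 : K) := isIntegral_natCast 2
  have hp1 : 0 < ι α - 1 := by linarith
  have hp2 : 0 < ι α - 2 := by linarith
  refine finrank_le_of_isIntegral hreal ι (β := α * (α - 1) ^ 2 * (α - 2))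
    (B := 196 * 196 ^ 2 * 196) (c := 1 / 4)
    ((hα.mul ((hα.sub isIntegral_one).pow 2)).mul (hα.sub h2))
    ?_ ?_ ?_ (by norm_num) (by norm_num) (by norm_num)
  · simp only [map_mul, map_pow, map_sub, map_ofNat, map_one]
    positivity
  · simp only [map_mul, map_pow, map_sub, map_ofNat, map_one]
    gcongr <;> linarith
  · intro σ hne
    obtain ⟨hpos, hlt⟩ := hσ σ hne
    have hσs : σ s = 1 / 2 := by simp [hs', map_ofNat]
    rw [hσs] at hlt
    simpa only [map_mul, map_pow, map_sub, map_ofNat, map_one] using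
      abs_auxiliary_le_of_lt_two hpos (by linarith)

/-- The degree bound for `m = 5`. -/
lemma finrank_le_of_sin_sq_pi_div_five {K : Type*} [Field K] [Algebra ℚ K] [FiniteDimensional ℚ K]
    (hreal : ∀ σ : K →+* ℂ, ∀ x : K, (σ x).im = 0) (ι : K →+* ℝ) {α s : K}
    (hα : IsIntegral ℤ α) (hs : ι s = Real.sin (Real.pi / 5) ^ 2)
    (hσ : ∀ σ : K →+* ℝ, σ ≠ ι → 0 < σ α ∧ σ α < 4 * σ s)
    (h4 : 4 < ι α) (h196 : ι α < 196) : Module.finrank ℚ K ≤ 24 := by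
  obtain ⟨t, ht⟩ : ∃ t, t = 4 * s := ⟨_, rfl⟩
  have h5 : √5 ^ 2 = 5 := Real.sq_sqrt (by norm_num)
  have hιt : ι t = (5 - √5) / 2 := by
    rw [← four_mul_sin_sq_pi_div_five_eq, ht, map_mul, map_ofNat, hs]
  have hteq : t ^ 2 - 5 * t + 5 = 0 := by
    apply ι.injective
    simp only [map_add, map_sub, map_mul, map_pow, map_ofNat, map_zero, hιt]
    linear_combination h5 / 4
  have htint : IsIntegral ℤ t := by
    refine ⟨Polynomial.X ^ 2 - 5 * Polynomial.X + 5, by monicity!, ?_⟩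
    simpa using hteq
  have h3 : IsIntegral ℤ (3 : K) := isIntegral_natCast 3
  have hsqrt2 : 2 ≤ √5 := Real.le_sqrt_of_sq_le (by norm_num)
  have hsqrt3 : √5 ≤ 3 := Real.sqrt_le_iff.mpr (by norm_num)
  have hp1 : 0 < 3 - ι t := by linarith
  have hp2 : 0 < ι α - ι t := by linarith
  have hp3 : 0 < ι α - 1 := by linarith
  have hp4 : 0 < ι α - ι t + 1 := by linarith
  refine finrank_le_of_isIntegral hreal ι
    (β := (3 - t) ^ 4 * (α * (α - t) * (α - 1) * (α - t + 1)))
    (B := 2 ^ 4 * (196 * 196 * 196 * 196)) (c := 5 / 16)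
    (((h3.sub htint).pow 4).mul (((hα.mul (hα.sub htint)).mul (hα.sub isIntegral_one)).mul
      ((hα.sub htint).add isIntegral_one)))
    ?_ ?_ ?_ (by norm_num) (by norm_num) (by norm_num)
  · simp only [map_mul, map_pow, map_sub, map_add, map_ofNat, map_one]
    positivity
  · simp only [map_mul, map_pow, map_sub, map_add, map_ofNat, map_one]
    gcongr <;> linarith
  · intro σ hne
    obtain ⟨hpos, hlt⟩ := hσ σ hne
    have hσt : σ t ^ 2 - 5 * σ t + 5 = 0 := by
      simpa [map_ofNat] using congrArg σ hteq
    have hlt' : σ α < σ t := by simpa [ht, map_ofNat] using hlt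
    simpa only [map_mul, map_pow, map_sub, map_add, map_ofNat, map_one] using
      abs_auxiliary_le_of_sq_eq hσt hpos hlt'

/-- **Degree bound for small `m`.** Let `m ∈ {3, 4, 5}` and `K = ℚ(α)` a totally real
number field (realized inside `ℝ`) with `cos(2π/m) ∈ K`, where `α` is an algebraic
integer such that for every real embedding `σ ≠ id`, `0 < σ(α) < 4 σ(sin²(π/m))`,
while `4 < α < 14²`.  Then `[K : ℚ] ≤ 76` if `m = 3`, `[K : ℚ] ≤ 31` if `m = 4`, and
`[K : ℚ] ≤ 24` if `m = 5`. -/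
theorem degree_bound_small_m
    (m : ℕ) (hm : m = 3 ∨ m = 4 ∨ m = 5)
    (K : IntermediateField ℚ ℝ) [FiniteDimensional ℚ K]
    (hKtotreal : ∀ σ : K →+* ℂ, ∀ x : K, (σ x).im = 0)
    (hcos : Real.cos (2 * Real.pi / m) ∈ K)
    (α : K) (hαint : IsIntegral ℤ (α : ℝ))
    (hKα : K = IntermediateField.adjoin ℚ {(α : ℝ)})
    (sm : K) (hsm : (sm : ℝ) = Real.sin (Real.pi / m) ^ 2)
    (hσ : ∀ σ : K →+* ℝ, σ ≠ algebraMap K ℝ →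
      0 < σ α ∧ σ α < 4 * σ sm)
    (hgeo : 4 < (α : ℝ) ∧ (α : ℝ) < 14 ^ 2) :
    (m = 3 → Module.finrank ℚ K ≤ 76) ∧
    (m = 4 → Module.finrank ℚ K ≤ 31) ∧
    (m = 5 → Module.finrank ℚ K ≤ 24) := by
  have hα : IsIntegral ℤ α := (isIntegral_algebraMap_iff (algebraMap K ℝ).injective).mp hαint
  have h196 : (α : ℝ) < 196 := by linarith [hgeo.2]
  refine ⟨?_, ?_, ?_⟩
  · rintro rfl
    exact finrank_le_of_sin_sq_pi_div_three hKtotreal (algebraMap K ℝ) hα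
      (by exact_mod_cast hsm) hσ hgeo.1 h196
  · rintro rfl
    exact finrank_le_of_sin_sq_pi_div_four hKtotreal (algebraMap K ℝ) hα
      (by exact_mod_cast hsm) hσ hgeo.1 h196
  · rintro rfl
    exact finrank_le_of_sin_sq_pi_div_five hKtotreal (algebraMap K ℝ) hα
      (by exact_mod_cast hsm) hσ hgeo.1 h196
end

section
/- For every integer l ≥ 3, the norm from F_l = ℚ(cos(2π/l)) to ℚ of the element 4 sin²(2π/l) equals γ̃(l), where γ̃(l) = γ(l) if l is odd, γ̃(l) = γ(l/2) if l is even with l/2 ≥ 3 odd, γ̃(l) = γ(l/2)² if l is even with l/2 ≥ 4 even, and γ̃(4) = 4. -/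
open scoped Classical in
/-- `γ(l) = p` if `l = p^t` is a prime power (`t ≥ 1`), and `γ(l) = 1` otherwise. -/
noncomputable def gam (l : ℕ) : ℕ := if IsPrimePow l then l.minFac else 1

/-- `γ̃(l) = γ(l)` if `l` is odd, `γ̃(l) = γ(l/2)` if `l` is even with `l/2 ≥ 3` odd,
`γ̃(l) = γ(l/2)²` if `l` is even with `l/2 ≥ 4` even, and `γ̃(4) = 4`. -/
noncomputable def gamTilde (l : ℕ) : ℕ :=
  if l = 4 then 4
  else if l % 2 = 1 then gam l
  else if (l / 2) % 2 = 1 then gam (l / 2)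
  else gam (l / 2) ^ 2

open Polynomial IntermediateField Module

/-- In an extension with power basis generated by `θ`, the norm of `r - θ` is the value at `r` of
the minimal polynomial of `θ`. -/
theorem PowerBasis.norm_algebraMap_sub_gen {K S : Type*} [Field K] [CommRing S] [Algebra K S]
    (pb : PowerBasis K S) (r : K) :
    Algebra.norm K (algebraMap K S r - pb.gen) = (minpoly K pb.gen).eval r := by
  rw [← charpoly_leftMulMatrix pb, Matrix.eval_charpoly, Algebra.norm_eq_matrix_det pb.basis,
    map_sub, AlgHom.commutes]
  rfl

/-- The norm of `r - x` is a power of the value at `r` of the minimal polynomial of `x`. -/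
theorem norm_algebraMap_sub_eq_eval_minpoly_pow {K L : Type*} [Field K] [Field L]
    [Algebra K L] [FiniteDimensional K L] (r : K) (x : L) :
    Algebra.norm K (algebraMap K L r - x) = (minpoly K x).eval r ^ finrank K⟮x⟯ L := by
  have hx : IsIntegral K x := IsIntegral.of_finite K x
  have h := (IntermediateField.adjoin.powerBasis hx).norm_algebraMap_sub_gen r
  rw [IntermediateField.adjoin.powerBasis_gen, minpoly_gen] at h
  have hcoe : algebraMap K L r - x
      = algebraMap K⟮x⟯ L (algebraMap K K⟮x⟯ r - AdjoinSimple.gen K x) := by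
    rw [map_sub, AdjoinSimple.algebraMap_gen, ← IsScalarTower.algebraMap_apply]
  rw [hcoe, ← Algebra.norm_norm (S := K⟮x⟯), Algebra.norm_algebraMap, map_pow, h]

/-- If `K = F(ζ)` with `ζ ∉ F` and `ζ + ζ⁻¹ = c ∈ F`, then `1 - ζ²` has norm `4 - c²`. -/
theorem norm_one_sub_sq_of_quadratic {F K : Type*} [Field F] [Field K] [Algebra F K]
    [FiniteDimensional F K] {ζ : K} {c : F} (htop : F⟮ζ⟯ = ⊤)
    (hζ : ζ ∉ (algebraMap F K).range) (hc : ζ ^ 2 - algebraMap F K c * ζ + 1 = 0) :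
    Algebra.norm F (1 - ζ ^ 2) = 4 - c ^ 2 := by
  have hint : IsIntegral F ζ := IsIntegral.of_finite F ζ
  have hdeg : (X ^ 2 - C c * X + 1 : F[X]).natDegree = 2 := by compute_degree!
  have hmonic : (X ^ 2 - C c * X + 1 : F[X]).Monic := by monicity!
  have hmin : minpoly F ζ = X ^ 2 - C c * X + 1 := by
    refine (eq_of_monic_of_dvd_of_natDegree_le (minpoly.monic hint) hmonic
      (minpoly.dvd F ζ (by simpa using hc)) ?_).symm
    rw [hdeg]
    exact (minpoly.two_le_natDegree_iff hint).2 hζ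
  have hfin : finrank F⟮ζ⟯ K = 1 := by rw [htop, IntermediateField.finrank_top]
  have hone := norm_algebraMap_sub_eq_eval_minpoly_pow (1 : F) ζ
  have hneg := norm_algebraMap_sub_eq_eval_minpoly_pow (-1 : F) ζ
  rw [hfin, hmin] at hone hneg
  have hfact : 1 - ζ ^ 2
      = (algebraMap F K 1 - ζ) * (algebraMap F K (-1) - ζ) * algebraMap F K (-1) := by
    simp only [map_neg, map_one]; ring
  have hfinrank : finrank F K = 2 := by
    rw [← finrank_top', ← htop, adjoin.finrank hint, hmin, hdeg]
  rw [hfact, map_mul, map_mul, hone, hneg, Algebra.norm_algebraMap, hfinrank]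
  simp
  ring

theorem eval_one_cyclotomic_eq_gam {m : ℕ} (hm : 2 ≤ m) :
    (cyclotomic m ℚ).eval 1 = (gam m : ℚ) := by
  unfold gam
  split_ifs with h
  · obtain ⟨p, k, hp, hk, rfl⟩ := h
    have hp' := hp.nat_prime
    have : Fact p.Prime := ⟨hp'⟩
    obtain ⟨k, rfl⟩ := Nat.exists_eq_succ_of_ne_zero hk.ne'
    rw [Nat.succ_eq_add_one, eval_one_cyclotomic_prime_pow, hp'.pow_minFac (by omega)]
  · rw [eval_one_cyclotomic_not_prime_pow, Nat.cast_one]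
    rintro p hp k rfl
    refine h (hp.isPrimePow.pow ?_)
    rintro rfl
    simp at hm

/-- The norm of `1 - η` for a primitive `m`-th root of unity `η` in a number field whose degree is
`e` times `φ(m)`. -/
theorem norm_one_sub_of_isPrimitiveRoot {K : Type*} [Field K] [Algebra ℚ K]
    [FiniteDimensional ℚ K] {η : K} {m e : ℕ} (hm : 2 ≤ m) (hη : IsPrimitiveRoot η m)
    (he : finrank ℚ K = m.totient * e) :
    Algebra.norm ℚ (1 - η) = (gam m : ℚ) ^ e := by
  have h := norm_algebraMap_sub_eq_eval_minpoly_pow (1 : ℚ) η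
  have : NeZero (m : ℚ) := ⟨by exact_mod_cast (by omega : m ≠ 0)⟩
  have hmin : minpoly ℚ η = cyclotomic m ℚ := 
    (hη.minpoly_eq_cyclotomic_of_irreducible (cyclotomic.irreducible_rat (by omega))).symm
  have hdeg : finrank ℚ ℚ⟮η⟯ = m.totient := by
    rw [adjoin.finrank (IsIntegral.of_finite ℚ η), hmin, natDegree_cyclotomic]
  have hfin : finrank ℚ⟮η⟯ K = e := by
    have := finrank_mul_finrank ℚ ℚ⟮η⟯ K
    rw [hdeg, he] at this
    exact Nat.eq_of_mul_eq_mul_left (Nat.totient_pos.2 (by omega)) this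
  rwa [map_one, hmin, eval_one_cyclotomic_eq_gam hm, hfin] at h

theorem norm_one_sub_sq_of_isPrimitiveRoot {K : Type*} [Field K] [Algebra ℚ K]
    [FiniteDimensional ℚ K] {ζ : K} {l : ℕ} (hl : 3 ≤ l) (hζ : IsPrimitiveRoot ζ l)
    (hK : finrank ℚ K = l.totient) :
    Algebra.norm ℚ (1 - ζ ^ 2) = (gamTilde l : ℚ) := by
  rcases Nat.even_or_odd' l with ⟨m, rfl | rfl⟩
  · have hζ2 : IsPrimitiveRoot (ζ ^ 2) m := hζ.pow (by omega) rfl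
    rcases Nat.even_or_odd m with hm | hm
    · have he : finrank ℚ K = m.totient * 2 := by
        rw [hK, Nat.totient_mul_of_prime_of_dvd Nat.prime_two hm.two_dvd, mul_comm]
      rw [norm_one_sub_of_isPrimitiveRoot (by omega) hζ2 he]
      have hm2 : m % 2 ≠ 1 := by have := Nat.even_iff.1 hm; omega
      unfold gamTilde
      by_cases h4 : 2 * m = 4
      · obtain rfl : m = 2 := by omega
        norm_num [gam, Nat.prime_two.isPrimePow]
      · simp [h4, hm2]
    · have he : finrank ℚ K = m.totient * 1 := by
        rw [hK, Nat.totient_mul_of_prime_of_not_dvd Nat.prime_two hm.not_two_dvd_nat]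
        simp
      rw [norm_one_sub_of_isPrimitiveRoot (by omega) hζ2 he]
      have hm2 : m % 2 = 1 := Nat.odd_iff.1 hm
      have h4 : 2 * m ≠ 4 := by omega
      simp [gamTilde, h4, hm2]
  · have hζ2 : IsPrimitiveRoot (ζ ^ 2) (2 * m + 1) :=
      hζ.pow_of_coprime 2 (by simp)
    rw [norm_one_sub_of_isPrimitiveRoot (e := 1) (by omega) hζ2 (by rw [hK, mul_one])]
    have h4 : 2 * m + 1 ≠ 4 := by omega
    have h1 : (2 * m + 1) % 2 = 1 := by omega
    simp only [gamTilde, h4, h1, if_true, if_false, pow_one]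

/-- If `F` is a proper subfield of the `l`-th cyclotomic field containing `c = ζ + ζ⁻¹`, then
`4 - c²` has norm `γ̃(l)`. -/
theorem norm_four_sub_sq_of_isCyclotomicExtension {F K : Type*} [Field F] [Field K] [Algebra ℚ F]
    [Algebra ℚ K] [Algebra F K] {ζ : K} {c : F} {l : ℕ} (hl : 3 ≤ l)
    [IsCyclotomicExtension {l} ℚ K] (hζ : IsPrimitiveRoot ζ l)
    (hmem : ζ ∉ (algebraMap F K).range) (hc : ζ ^ 2 - algebraMap F K c * ζ + 1 = 0) :
    Algebra.norm ℚ (4 - c ^ 2) = (gamTilde l : ℚ) := by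
  have : NeZero l := ⟨by omega⟩
  have : FiniteDimensional ℚ K := IsCyclotomicExtension.finiteDimensional {l} ℚ K
  have : FiniteDimensional F K := FiniteDimensional.right ℚ F K
  have : FiniteDimensional ℚ F := FiniteDimensional.left ℚ F K
  have htop : F⟮ζ⟯ = ⊤ := by
    refine eq_top_iff.2 fun y _ => ?_
    have hy : y ∈ Algebra.adjoin ℚ {ζ} := by
      rw [IsCyclotomicExtension.adjoin_primitive_root_eq_top hζ]; trivial
    have hle : Algebra.adjoin ℚ {ζ} ≤ (F⟮ζ⟯.toSubalgebra.restrictScalars ℚ) :=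
      Algebra.adjoin_le (by simp)
    exact hle hy
  rw [← norm_one_sub_sq_of_quadratic htop hmem hc, Algebra.norm_norm,
    norm_one_sub_sq_of_isPrimitiveRoot hl hζ
      (IsCyclotomicExtension.finrank K (cyclotomic.irreducible_rat (by omega)))]

/-- For every integer `l ≥ 3`, the norm from `F_l = ℚ(cos(2π/l))` to `ℚ` of the
element `4 sin²(2π/l)` equals `γ̃(l)`. -/
theorem norm_four_sin_sq_two (l : ℕ) (hl : 3 ≤ l)
    (F : IntermediateField ℚ ℝ)
    (hF : F = IntermediateField.adjoin ℚ {Real.cos (2 * Real.pi / l)})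
    (x : F) (hx : (x : ℝ) = 4 * Real.sin (2 * Real.pi / l) ^ 2) :
    Algebra.norm ℚ x = (gamTilde l : ℚ) := by
  have : NeZero l := ⟨by omega⟩
  have hl0 : (0 : ℝ) < l := by exact_mod_cast (by omega : 0 < l)
  set θ : ℝ := 2 * Real.pi / l with hθ
  set z : ℂ := Complex.exp (2 * Real.pi * Complex.I / l) with hz
  have hprim : IsPrimitiveRoot z l := Complex.isPrimitiveRoot_exp l (by omega)
  have hzθ : z = Complex.cos θ + Complex.sin θ * Complex.I := by
    rw [← Complex.exp_mul_I, hz, hθ]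
    push_cast
    ring_nf
  have hpyth : Complex.sin θ ^ 2 + Complex.cos θ ^ 2 = 1 := Complex.sin_sq_add_cos_sq _
  have hquad : z ^ 2 - 2 * Complex.cos θ * z + 1 = 0 := by
    rw [hzθ]
    linear_combination Complex.sin θ ^ 2 * Complex.I_sq - hpyth
  have hsin : 0 < Real.sin θ := by
    have h3 : (3 : ℝ) ≤ l := by exact_mod_cast hl
    refine Real.sin_pos_of_pos_of_lt_pi (by positivity) ?_
    rw [hθ, div_lt_iff₀ hl0]
    nlinarith [Real.pi_pos]
  have hcosF : Real.cos θ ∈ F := hF ▸ mem_adjoin_simple_self ℚ _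
  have : IsCyclotomicExtension {l} ℚ ℚ⟮z⟯ := by
    have hint : IsIntegral ℚ z := (hprim.isIntegral (by omega)).tower_top
    change IsCyclotomicExtension {l} ℚ ℚ⟮z⟯.toSubalgebra
    rw [adjoin_simple_toSubalgebra_of_isAlgebraic hint.isAlgebraic]
    exact hprim.adjoin_isCyclotomicExtension ℚ
  let ζ : ℚ⟮z⟯ := AdjoinSimple.gen ℚ z
  have hcosK : Complex.cos θ ∈ ℚ⟮z⟯ := by
    have hzmem : z ∈ ℚ⟮z⟯ := mem_adjoin_simple_self ℚ z
    have hz0 : z ≠ 0 := Complex.exp_ne_zero _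
    have : Complex.cos θ = (z + z⁻¹) / 2 := by
      field_simp
      linear_combination -hquad
    rw [this]
    exact div_mem (add_mem hzmem (inv_mem hzmem)) (_root_.ofNat_mem _ 2)
  have hFK : ∀ y : F, ((y : ℝ) : ℂ) ∈ ℚ⟮z⟯ := by
    have hle : F ≤ ℚ⟮z⟯.comap (IsScalarTower.toAlgHom ℚ ℝ ℂ) := by
      rw [hF, adjoin_simple_le_iff]
      
      change ((Real.cos θ : ℝ) : ℂ) ∈ ℚ⟮z⟯
      rwa [Complex.ofReal_cos]
    exact fun y => hle y.2
  let : Algebra F ℚ⟮z⟯ :=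
    ((Complex.ofRealHom.comp (algebraMap F ℝ)).codRestrict ℚ⟮z⟯ hFK).toAlgebra
  have hmap : ∀ y : F, ((algebraMap F ℚ⟮z⟯ y : ℚ⟮z⟯) : ℂ) = ((y : ℝ) : ℂ) := fun _ => rfl
  have hxc : x = 4 - (2 * ⟨Real.cos θ, hcosF⟩ : F) ^ 2 := by
    apply Subtype.ext
    change (x : ℝ) = 4 - (2 * Real.cos θ) ^ 2
    rw [hx]
    linear_combination 4 * Real.sin_sq_add_cos_sq θ
  rw [hxc]
  refine norm_four_sub_sq_of_isCyclotomicExtension (K := ℚ⟮z⟯) (ζ := ζ) hl ?_ ?_ ?_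
  · exact IsPrimitiveRoot.coe_submonoidClass_iff.1 hprim
  · rintro ⟨y, hy⟩
    have him := congrArg (fun w : ℚ⟮z⟯ => (w : ℂ).im) hy
    simp only [hmap, ζ, AdjoinSimple.coe_gen, hzθ, Complex.ofReal_im] at him
    simp [← Complex.ofReal_cos, ← Complex.ofReal_sin] at him
    exact hsin.ne him
  · apply Subtype.ext
    change z ^ 2 - ((2 * Real.cos θ : ℝ) : ℂ) * z + 1 = 0
    push_cast
    exact hquad
end

section
/- For all integers k, s ≥ 3, the field F_{k,s} = ℚ(cos(2π/k), cos(2π/s)) has degree [F_{k,s} : ℚ] = φ(lcm(k,s))/(2ρ(k,s)) over ℚ, where ρ(k,s) = 2 if gcd(k,s) divides 2 and ρ(k,s) = 1 otherwise. -/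
/-- `ρ(k,s) = 2` if `gcd(k,s) ∣ 2` and `ρ(k,s) = 1` otherwise. -/
def rho (k s : ℕ) : ℕ := if Nat.gcd k s ∣ 2 then 2 else 1

open IntermediateField IsCyclotomicExtension

section Units

variable {k s : ℕ}

/-- The units modulo `lcm k s` that are `±1` both modulo `k` and modulo `s`. -/
def lcmSignUnits (k s : ℕ) : Set (ZMod (k.lcm s))ˣ :=
  {u | (ZMod.unitsMap (Nat.dvd_lcm_left k s) u = 1 ∨ ZMod.unitsMap (Nat.dvd_lcm_left k s) u = -1) ∧
    (ZMod.unitsMap (Nat.dvd_lcm_right k s) u = 1 ∨ ZMod.unitsMap (Nat.dvd_lcm_right k s) u = -1)}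

theorem ZMod.unitsMap_lcm_ext {u v : (ZMod (k.lcm s))ˣ}
    (h₁ : ZMod.unitsMap (Nat.dvd_lcm_left k s) u = ZMod.unitsMap (Nat.dvd_lcm_left k s) v)
    (h₂ : ZMod.unitsMap (Nat.dvd_lcm_right k s) u = ZMod.unitsMap (Nat.dvd_lcm_right k s) v) :
    u = v := by
  rw [Units.ext_iff, ZMod.unitsMap_val, ZMod.unitsMap_val] at h₁ h₂
  obtain ⟨a, ha⟩ := ZMod.intCast_surjective (u : ZMod (k.lcm s))
  obtain ⟨b, hb⟩ := ZMod.intCast_surjective (v : ZMod (k.lcm s))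
  rw [← ha, ← hb, ZMod.cast_intCast (Nat.dvd_lcm_left k s), ZMod.cast_intCast
    (Nat.dvd_lcm_left k s), ZMod.intCast_eq_intCast_iff_dvd_sub] at h₁
  rw [← ha, ← hb, ZMod.cast_intCast (Nat.dvd_lcm_right k s), ZMod.cast_intCast
    (Nat.dvd_lcm_right k s), ZMod.intCast_eq_intCast_iff_dvd_sub] at h₂
  rw [Units.ext_iff, ← ha, ← hb, ZMod.intCast_eq_intCast_iff_dvd_sub]
  exact Int.coe_lcm_dvd h₁ h₂

theorem ZMod.unitsMap_neg_one {m n : ℕ} (h : m ∣ n) : ZMod.unitsMap h (-1) = -1 := by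
  ext
  simp [ZMod.unitsMap_def]

theorem ZMod.unitsMap_neg {m n : ℕ} (h : m ∣ n) (u : (ZMod n)ˣ) :
    ZMod.unitsMap h (-u) = -ZMod.unitsMap h u := by
  rw [← neg_one_mul, map_mul, ZMod.unitsMap_neg_one, neg_one_mul]

theorem ZMod.units_one_ne_neg_one {n : ℕ} (hn : 3 ≤ n) : (1 : (ZMod n)ˣ) ≠ -1 := by
  have : Fact (2 < n) := ⟨hn⟩
  intro h
  exact ZMod.neg_one_ne_one (congrArg Units.val h).symm

/-- A unit that is `1` modulo `k` and `-1` modulo `s` exists exactly when `gcd k s ∣ 2`. -/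
theorem ZMod.exists_unitsMap_lcm_eq_one_neg_one_iff :
    (∃ c : (ZMod (k.lcm s))ˣ, ZMod.unitsMap (Nat.dvd_lcm_left k s) c = 1 ∧
      ZMod.unitsMap (Nat.dvd_lcm_right k s) c = -1) ↔ k.gcd s ∣ 2 := by
  constructor
  · rintro ⟨c, h₁, h₂⟩
    rw [Units.ext_iff, ZMod.unitsMap_val] at h₁ h₂
    obtain ⟨a, ha⟩ := ZMod.intCast_surjective (c : ZMod (k.lcm s))
    rw [← ha, ZMod.cast_intCast (Nat.dvd_lcm_left k s), Units.val_one, ← Int.cast_one,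
      ZMod.intCast_eq_intCast_iff_dvd_sub] at h₁
    rw [← ha, ZMod.cast_intCast (Nat.dvd_lcm_right k s), Units.val_neg, Units.val_one,
      ← Int.cast_one, ← Int.cast_neg, ZMod.intCast_eq_intCast_iff_dvd_sub] at h₂
    have g₁ := (Int.natCast_dvd_natCast.mpr (Nat.gcd_dvd_left k s)).trans h₁
    have g₂ := (Int.natCast_dvd_natCast.mpr (Nat.gcd_dvd_right k s)).trans h₂
    have := dvd_sub g₁ g₂
    rw [show (1 - a) - (-1 - a) = ((2 : ℕ) : ℤ) by push_cast; ring] at this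
    exact Int.natCast_dvd_natCast.mp this
  · intro h
    obtain ⟨x, y, hxy⟩ := (Int.gcd_dvd_iff (a := k) (b := s) (n := 2)).mp (by simpa using h)
    have hc : ((1 - k * x : ℤ) : ZMod (k.lcm s)) * ((1 - k * x : ℤ) : ZMod (k.lcm s)) = 1 := by
      rw [← Int.cast_mul, ← Int.cast_one (R := ZMod (k.lcm s)), ZMod.intCast_eq_intCast_iff_dvd_sub]
      have e : (1 : ℤ) - (1 - k * x) * (1 - k * x) = k * x * (s * y) := by
        have : (s : ℤ) * y = 2 - k * x := by push_cast at hxy; linarith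
        rw [this]; ring
      rw [e]
      exact Int.coe_lcm_dvd (a := k) (b := s) ⟨x * (s * y), by ring⟩ ⟨k * x * y, by ring⟩
    refine ⟨⟨_, _, hc, hc⟩, ?_, ?_⟩
    · rw [Units.ext_iff, ZMod.unitsMap_val, ZMod.cast_intCast (Nat.dvd_lcm_left k s)]
      simp
    · rw [Units.ext_iff, ZMod.unitsMap_val, ZMod.cast_intCast (Nat.dvd_lcm_right k s),
        show (1 : ℤ) - k * x = s * y - 1 by push_cast at hxy; linarith]
      simp

theorem ncard_lcmSignUnits (hk : 3 ≤ k) (hs : 3 ≤ s) : (lcmSignUnits k s).ncard = 2 * rho k s := by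
  have hk1 := ZMod.units_one_ne_neg_one hk
  have hs1 := ZMod.units_one_ne_neg_one hs
  have hn1 : (1 : (ZMod (k.lcm s))ˣ) ≠ -1 := by
    intro h
    apply hk1
    simpa [ZMod.unitsMap_neg] using congrArg (ZMod.unitsMap (Nat.dvd_lcm_left k s)) h
  by_cases h : k.gcd s ∣ 2
  · obtain ⟨c, h₁, h₂⟩ := ZMod.exists_unitsMap_lcm_eq_one_neg_one_iff.mpr h
    have hS : lcmSignUnits k s = {1, -1, c, -c} := by
      ext u
      simp only [lcmSignUnits, Set.mem_ofPred_eq, Set.mem_insert_iff, Set.mem_singleton_iff]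
      constructor
      · rintro ⟨hu | hu, hv | hv⟩
        · exact .inl (ZMod.unitsMap_lcm_ext (by simp [hu]) (by simp [hv]))
        · exact .inr (.inr (.inl (ZMod.unitsMap_lcm_ext (by simp [hu, h₁]) (by simp [hv, h₂]))))
        · exact .inr (.inr (.inr (ZMod.unitsMap_lcm_ext (by simp [hu, ZMod.unitsMap_neg, h₁])
            (by simp [hv, ZMod.unitsMap_neg, h₂]))))
        · exact .inr (.inl (ZMod.unitsMap_lcm_ext (by simp [hu, ZMod.unitsMap_neg])
            (by simp [hv, ZMod.unitsMap_neg])))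
      · rintro (rfl | rfl | rfl | rfl) <;> simp [ZMod.unitsMap_neg, *]
    have hc1 : c ≠ 1 := by rintro rfl; exact hs1 (by simpa using h₂)
    have hc2 : c ≠ -1 := by
      rintro rfl
      exact hk1 (by simpa [ZMod.unitsMap_neg] using h₁.symm)
    have hc3 : c ≠ -c := by
      intro h
      apply hk1
      simpa [ZMod.unitsMap_neg, h₁] using congrArg (ZMod.unitsMap (Nat.dvd_lcm_left k s)) h
    rw [hS, rho, if_pos h, Set.ncard_insert_of_notMem, Set.ncard_insert_of_notMem,
      Set.ncard_pair hc3]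
    · simp [hc1.symm, hc2.symm]
    · simp only [Set.mem_insert_iff, Set.mem_singleton_iff, not_or]
      exact ⟨hn1, hc1.symm, fun e => hc2 (by rw [e, neg_neg])⟩
  · have hS : lcmSignUnits k s = {1, -1} := by
      ext u
      simp only [lcmSignUnits, Set.mem_ofPred_eq, Set.mem_insert_iff, Set.mem_singleton_iff]
      constructor
      · rintro ⟨hu | hu, hv | hv⟩
        · exact .inl (ZMod.unitsMap_lcm_ext (by simp [hu]) (by simp [hv]))
        · exact absurd (ZMod.exists_unitsMap_lcm_eq_one_neg_one_iff.mp ⟨u, hu, hv⟩) h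
        · exact absurd (ZMod.exists_unitsMap_lcm_eq_one_neg_one_iff.mp
            ⟨-u, by simp [ZMod.unitsMap_neg, hu], by simp [ZMod.unitsMap_neg, hv]⟩) h
        · exact .inr (ZMod.unitsMap_lcm_ext (by simp [hu, ZMod.unitsMap_neg])
            (by simp [hv, ZMod.unitsMap_neg]))
      · rintro (rfl | rfl) <;> simp [ZMod.unitsMap_neg]
    rw [hS, rho, if_neg h, Set.ncard_pair hn1]

end Units

theorem add_inv_eq_add_inv_iff {K : Type*} [Field K] {x y : K} (hx : x ≠ 0) (hy : y ≠ 0) :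
    x + x⁻¹ = y + y⁻¹ ↔ x = y ∨ x = y⁻¹ := by
  constructor
  · intro h
    have : (x - y) * (x * y - 1) = 0 := by
      field_simp at h
      linear_combination h
    rcases mul_eq_zero.mp this with h | h
    · exact .inl (sub_eq_zero.mp h)
    · exact .inr (eq_inv_of_mul_eq_one_left (sub_eq_zero.mp h))
  · rintro (rfl | rfl)
    · rfl
    · rw [inv_inv, add_comm]

/-- An automorphism of a cyclotomic field fixes `(a + a⁻¹) / 2`, for `a` a primitive `k`-th root
of unity, iff the corresponding unit is `±1` modulo `k`. -/
theorem gal_apply_half_add_inv_eq_iff {n k : ℕ} [NeZero n] {E : Type*} [Field E] [NumberField E]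
    [IsCyclotomicExtension {n} ℚ E] (hkn : k ∣ n) {a : E} (ha : IsPrimitiveRoot a k)
    (σ : Gal(E/ℚ)) :
    σ ((a + a⁻¹) / 2) = (a + a⁻¹) / 2 ↔
      ZMod.unitsMap hkn (Rat.galEquivZMod n E σ) = 1 ∨
        ZMod.unitsMap hkn (Rat.galEquivZMod n E σ) = -1 := by
  have hk0 : k ≠ 0 := fun h => NeZero.ne n (Nat.eq_zero_of_zero_dvd (h ▸ hkn))
  have ha0 : a ≠ 0 := ha.ne_zero hk0
  have hσ := Rat.galEquivZMod_apply_of_pow_eq n E σ ((ha.pow_eq_one_iff_dvd n).mpr hkn)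
  have hmap : σ ((a + a⁻¹) / 2) = (σ a + (σ a)⁻¹) / 2 := by
    rw [map_div₀, map_add, map_inv₀, map_ofNat]
  rw [hmap, div_left_inj' two_ne_zero,
    add_inv_eq_add_inv_iff ((map_ne_zero σ).mpr ha0) ha0, hσ]
  generalize Rat.galEquivZMod n E σ = u
  have hu : ((ZMod.unitsMap hkn u : (ZMod k)ˣ) : ZMod k) = ((u.val.val : ℤ) : ZMod k) := by
    rw [ZMod.unitsMap_val, Int.cast_natCast, ZMod.natCast_val]
  apply or_congr
  · rw [Units.ext_iff, hu, Units.val_one, ← Int.cast_one, eq_comm (b := ((1 : ℤ) : ZMod k)),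
      ZMod.intCast_eq_intCast_iff_dvd_sub, ← ha.zpow_eq_one_iff_dvd, zpow_sub₀ ha0, zpow_one,
      zpow_natCast, div_eq_one_iff_eq ha0]
  · rw [Units.ext_iff, hu, Units.val_neg, Units.val_one, ← Int.cast_one, ← Int.cast_neg,
      eq_comm (b := ((-1 : ℤ) : ZMod k)), ZMod.intCast_eq_intCast_iff_dvd_sub,
      ← ha.zpow_eq_one_iff_dvd, zpow_sub₀ ha0, zpow_neg_one, zpow_natCast,
      div_eq_one_iff_eq (inv_ne_zero ha0)]

/-- The degree of the subfield of a cyclotomic field generated by two real parts of roots of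
unity. -/
theorem finrank_adjoin_half_add_inv {k s : ℕ} (hk : 3 ≤ k) (hs : 3 ≤ s) [NeZero (k.lcm s)]
    {E : Type*} [Field E] [NumberField E] [IsCyclotomicExtension {k.lcm s} ℚ E] {a b : E}
    (ha : IsPrimitiveRoot a k) (hb : IsPrimitiveRoot b s) :
    2 * rho k s * Module.finrank ℚ (adjoin ℚ {(a + a⁻¹) / 2, (b + b⁻¹) / 2}) =
      (k.lcm s).totient := by
  have := IsCyclotomicExtension.isGalois {k.lcm s} ℚ E
  set K := adjoin ℚ {(a + a⁻¹) / 2, (b + b⁻¹) / 2}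
  have hfix : (K.fixingSubgroup : Set Gal(E/ℚ)) =
      Rat.galEquivZMod (k.lcm s) E ⁻¹' lcmSignUnits k s := by
    ext σ
    rw [SetLike.mem_coe, IntermediateField.mem_fixingSubgroup_iff]
    have := forall_mem_adjoin_smul_eq_self_iff ℚ (S := {(a + a⁻¹) / 2, (b + b⁻¹) / 2}) σ
    simp only [AlgEquiv.smul_def] at this
    rw [this]
    simp only [Set.mem_insert_iff, Set.mem_singleton_iff, forall_eq_or_imp, forall_eq,
      gal_apply_half_add_inv_eq_iff (Nat.dvd_lcm_left k s) ha,
      gal_apply_half_add_inv_eq_iff (Nat.dvd_lcm_right k s) hb]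
    rfl
  have hcard : Nat.card K.fixingSubgroup = 2 * rho k s := by
    rw [← ncard_lcmSignUnits hk hs, ← Set.ncard_preimage_of_injective_subset_range
      (Rat.galEquivZMod (k.lcm s) E).injective (by simp), ← hfix]
    rfl
  rw [← hcard, IsGalois.card_fixingSubgroup_eq_finrank, mul_comm, Module.finrank_mul_finrank,
    IsCyclotomicExtension.finrank E
      (Polynomial.cyclotomic.irreducible_rat (NeZero.pos (k.lcm s)))]

theorem Complex.half_exp_add_inv_eq_cos (k : ℕ) :
    (Complex.exp (2 * Real.pi * Complex.I / k) +
      (Complex.exp (2 * Real.pi * Complex.I / k))⁻¹) / 2 = (Real.cos (2 * Real.pi / k) : ℂ) := by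
  rw [← Complex.exp_neg, Complex.ofReal_cos, Complex.cos]
  push_cast
  ring_nf

/-- For all integers `k, s ≥ 3`, the field `F_{k,s} = ℚ(cos(2π/k), cos(2π/s))` has
degree `[F_{k,s} : ℚ] = φ(lcm(k,s))/(2 ρ(k,s))` over `ℚ` (stated multiplicatively:
`2 ρ(k,s) [F_{k,s} : ℚ] = φ(lcm(k,s))`). -/
theorem degree_Fks (k s : ℕ) (hk : 3 ≤ k) (hs : 3 ≤ s)
    (F : IntermediateField ℚ ℝ)
    (hF : F = IntermediateField.adjoin ℚ
      {Real.cos (2 * Real.pi / k), Real.cos (2 * Real.pi / s)}) :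
    2 * rho k s * Module.finrank ℚ F = Nat.totient (Nat.lcm k s) := by
  have hn : k.lcm s ≠ 0 := Nat.lcm_ne_zero (by omega) (by omega)
  have : NeZero (k.lcm s) := ⟨hn⟩
  let E := CyclotomicField (k.lcm s) ℚ
  have : IsCyclotomicExtension {k.lcm s} ℚ E := CyclotomicField.isCyclotomicExtension _ _
  have hζ := zeta_spec (k.lcm s) ℚ E
  obtain ⟨j, hj⟩ := (hζ.embeddingsEquivPrimitiveRoots ℂ
    (Polynomial.cyclotomic.irreducible_rat (NeZero.pos _))).surjective
    ⟨_, (mem_primitiveRoots (NeZero.pos _)).mpr (Complex.isPrimitiveRoot_exp _ hn)⟩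
  replace hj := congrArg Subtype.val hj
  rw [IsPrimitiveRoot.embeddingsEquivPrimitiveRoots_apply_coe] at hj
  have exists_root (m : ℕ) (hm : m ∣ k.lcm s) : ∃ a : E, IsPrimitiveRoot a m ∧
      j ((a + a⁻¹) / 2) = (Real.cos (2 * Real.pi / m) : ℂ) := by
    obtain ⟨d, hd⟩ := hm
    refine ⟨zeta (k.lcm s) ℚ E ^ d, hζ.pow (NeZero.pos _) (by rw [hd, mul_comm]), ?_⟩
    have hdm : (d : ℂ) ≠ 0 ∧ (m : ℂ) ≠ 0 := by
      constructor <;> rw [Nat.cast_ne_zero] <;> rintro rfl <;> simp [hd] at hn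
    rw [map_div₀, map_add, map_inv₀, map_ofNat, map_pow, hj, ← Complex.exp_nat_mul,
      ← Complex.half_exp_add_inv_eq_cos,
      show (d : ℂ) * (2 * Real.pi * Complex.I / (k.lcm s : ℕ)) = 2 * Real.pi * Complex.I / m by
        rw [hd]
        push_cast
        have := hdm.1
        have := hdm.2
        field_simp]
  obtain ⟨a, ha, hja⟩ := exists_root k (Nat.dvd_lcm_left k s)
  obtain ⟨b, hb, hjb⟩ := exists_root s (Nat.dvd_lcm_right k s)
  have hmap : (adjoin ℚ {(a + a⁻¹) / 2, (b + b⁻¹) / 2}).map j =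
      F.map (Complex.ofRealAm.restrictScalars ℚ) := by
    rw [hF, adjoin_map, adjoin_map, Set.image_pair, Set.image_pair, hja, hjb]
    rfl
  rw [← finrank_adjoin_half_add_inv hk hs ha hb]
  congr 1
  exact (((equivMap _ j).trans (equivOfEq hmap)).trans
    (equivMap F (Complex.ofRealAm.restrictScalars ℚ)).symm).toLinearEquiv.finrank_eq.symm
end

section
/- Let k, s ≥ 3 be integers such that gcd(k,s) does not divide 2, and let m = lcm(k,s). Then ℚ(cos(2π/k), cos(2π/s)) = ℚ(cos(2π/m)). -/
/-- If `cos x` lies in a field `K`, then for every natural number `n`, so does `cos (n x)`, and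
`sin (n x)` is a `K`-multiple of `sin x`. -/
theorem IntermediateField.cos_sin_nat_mul_mem (K : IntermediateField ℚ ℝ) {x : ℝ}
    (hx : Real.cos x ∈ K) (n : ℕ) :
    Real.cos (n * x) ∈ K ∧ ∃ u ∈ K, Real.sin (n * x) = u * Real.sin x := by
  induction n with
  | zero => exact ⟨by simp, 0, zero_mem K, by simp⟩
  | succ n ih =>
    obtain ⟨hc, u, hu, hs⟩ := ih
    have e : ((n + 1 : ℕ) : ℝ) * x = n * x + x := by push_cast; ring
    rw [e, Real.cos_add, Real.sin_add, hs]
    refine ⟨?_, u * Real.cos x + Real.cos (n * x),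
      add_mem (mul_mem hu hx) hc, by ring⟩
    have e' : u * Real.sin x * Real.sin x = u * (1 - Real.cos x * Real.cos x) := by
      linear_combination u * Real.sin_sq_add_cos_sq x
    rw [e']
    exact sub_mem (mul_mem hc hx) (mul_mem hu (sub_mem (one_mem K) (mul_mem hx hx)))

/-- If `cos x` lies in a field `K`, then for every integer `n`, so does `cos (n x)`, and
`sin (n x)` is a `K`-multiple of `sin x`. -/
theorem IntermediateField.cos_sin_int_mul_mem (K : IntermediateField ℚ ℝ) {x : ℝ}
    (hx : Real.cos x ∈ K) (n : ℤ) :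
    Real.cos (n * x) ∈ K ∧ ∃ u ∈ K, Real.sin (n * x) = u * Real.sin x := by
  obtain ⟨m, rfl | rfl⟩ := n.eq_nat_or_neg
  · simpa using K.cos_sin_nat_mul_mem hx m
  · obtain ⟨hc, u, hu, hs⟩ := K.cos_sin_nat_mul_mem hx m
    exact ⟨by simpa using hc, -u, neg_mem hu, by simp [hs]⟩

/-- If `x` and `y` have a common integer multiple `z` with `sin z ≠ 0`, then a field containing
`cos x` and `cos y` contains `sin x * sin y`. -/
theorem IntermediateField.sin_mul_sin_mem (K : IntermediateField ℚ ℝ) {x y z : ℝ}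
    (hx : Real.cos x ∈ K) (hy : Real.cos y ∈ K) (p q : ℕ) (hp : p * x = z) (hq : q * y = z)
    (hz : Real.sin z ≠ 0) : Real.sin x * Real.sin y ∈ K := by
  obtain ⟨hc, u, hu, hus⟩ := K.cos_sin_nat_mul_mem hx p
  obtain ⟨-, v, hv, hvs⟩ := K.cos_sin_nat_mul_mem hy q
  rw [hp] at hc hus
  rw [hq] at hvs
  have hu0 : u ≠ 0 := by rintro rfl; simp_all
  have hv0 : v ≠ 0 := by rintro rfl; simp_all
  have e : Real.sin x * Real.sin y = (1 - Real.cos z * Real.cos z) / (u * v) := by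
    rw [eq_div_iff (mul_ne_zero hu0 hv0)]
    linear_combination (-(v * Real.sin y)) * hus - Real.sin z * hvs +
      Real.sin_sq_add_cos_sq z
  rw [e]
  exact div_mem (sub_mem (one_mem K) (mul_mem hc hc)) (mul_mem hu hv)

/-- Let `k, s ≥ 3` be integers such that `gcd(k,s)` does not divide `2`, and let
`m = lcm(k,s)`.  Then `ℚ(cos(2π/k), cos(2π/s)) = ℚ(cos(2π/m))`. -/
theorem Fks_eq_Fm (k s : ℕ) (hk : 3 ≤ k) (hs : 3 ≤ s)
    (h : ¬ Nat.gcd k s ∣ 2) :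
    IntermediateField.adjoin ℚ
        {Real.cos (2 * Real.pi / k), Real.cos (2 * Real.pi / s)} =
      IntermediateField.adjoin ℚ {Real.cos (2 * Real.pi / (Nat.lcm k s))} := by
  have hk0 : (k : ℝ) ≠ 0 := by positivity
  have hs0 : (s : ℝ) ≠ 0 := by positivity
  have hm0 : (Nat.lcm k s : ℝ) ≠ 0 := by
    exact_mod_cast Nat.lcm_ne_zero (by omega) (by omega)
  have hd0 : 0 < Nat.gcd k s := Nat.gcd_pos_of_pos_left _ (by omega)
  have hd : 3 ≤ Nat.gcd k s := by
    by_contra! hlt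
    interval_cases Nat.gcd k s <;> simp at h
  have hdR : (3 : ℝ) ≤ Nat.gcd k s := by exact_mod_cast hd
  have hdR0 : (Nat.gcd k s : ℝ) ≠ 0 := by positivity
  apply le_antisymm
  · have hm := IntermediateField.mem_adjoin_simple_self ℚ
      (Real.cos (2 * Real.pi / (Nat.lcm k s)))
    have hdiv : ∀ t : ℕ, t ∣ Nat.lcm k s → Real.cos (2 * Real.pi / t) ∈
        IntermediateField.adjoin ℚ {Real.cos (2 * Real.pi / (Nat.lcm k s))} := by
      rintro t ⟨n, hn⟩
      have e : 2 * Real.pi / t = n * (2 * Real.pi / (Nat.lcm k s)) := by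
        rw [hn] at hm0 ⊢
        push_cast at hm0 ⊢
        have := left_ne_zero_of_mul hm0
        have := right_ne_zero_of_mul hm0
        field_simp
      rw [e]
      exact (IntermediateField.cos_sin_nat_mul_mem _ hm n).1
    rw [IntermediateField.adjoin_le_iff]
    rintro _ (rfl | rfl)
    · exact hdiv k (Nat.dvd_lcm_left k s)
    · exact hdiv s (Nat.dvd_lcm_right k s)
  · rw [IntermediateField.adjoin_simple_le_iff]
    set K := IntermediateField.adjoin ℚ
      {Real.cos (2 * Real.pi / k), Real.cos (2 * Real.pi / s)}
    have hkK : Real.cos (2 * Real.pi / k) ∈ K :=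
      IntermediateField.subset_adjoin _ _ (by simp)
    have hsK : Real.cos (2 * Real.pi / s) ∈ K :=
      IntermediateField.subset_adjoin _ _ (by simp)
    have hsin : Real.sin (2 * Real.pi / (Nat.gcd k s)) ≠ 0 := by
      apply (Real.sin_pos_of_pos_of_lt_pi (by positivity) _).ne'
      rw [div_lt_iff₀ (by positivity)]
      nlinarith [Real.pi_pos]
    have hmul : ∀ t : ℕ, (t : ℝ) ≠ 0 → Nat.gcd k s ∣ t →
        ((t / Nat.gcd k s : ℕ) : ℝ) * (2 * Real.pi / t) = 2 * Real.pi / (Nat.gcd k s) := by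
      intro t ht hdvd
      rw [Nat.cast_div hdvd hdR0]
      field_simp
    have hss := K.sin_mul_sin_mem hkK hsK _ _ (hmul k hk0 (Nat.gcd_dvd_left k s))
      (hmul s hs0 (Nat.gcd_dvd_right k s)) hsin
    have hbez : (Nat.gcd k s : ℝ) = k * Nat.gcdA k s + s * Nat.gcdB k s := by
      exact_mod_cast Nat.gcd_eq_gcd_ab k s
    have hprod : (Nat.gcd k s : ℝ) * Nat.lcm k s = k * s := by
      exact_mod_cast Nat.gcd_mul_lcm k s
    have e : 2 * Real.pi / (Nat.lcm k s) =
        Nat.gcdB k s * (2 * Real.pi / k) + Nat.gcdA k s * (2 * Real.pi / s) := by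
      field_simp
      linear_combination -hprod + (Nat.lcm k s : ℝ) * hbez
    obtain ⟨hc, u, hu, hus⟩ := K.cos_sin_int_mul_mem hkK (Nat.gcdB k s)
    obtain ⟨hc', v, hv, hvs⟩ := K.cos_sin_int_mul_mem hsK (Nat.gcdA k s)
    rw [e, Real.cos_add, hus, hvs, mul_mul_mul_comm]
    exact sub_mem (mul_mem hc hc') (mul_mem (mul_mem hu hv) hss)
end

section
/- Let k, s ≥ 3 be integers such that gcd(k,s) divides 2. Then the discriminant of the field F_{k,s} = ℚ(cos(2π/k), cos(2π/s)) satisfies |discr F_{k,s}| = |discr F_k|^{φ(s)/2} · |discr F_s|^{φ(k)/2}, where F_k = ℚ(cos(2π/k)) and F_s = ℚ(cos(2π/s)). -/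
open IntermediateField NumberField

/-- If `ζ` is a primitive `n`-th root of unity and the subfield `F` of `ℝ` is generated by the real
number `c = (ζ + ζ⁻¹) / 2`, then `F(ζ)` is the `n`-th cyclotomic field. -/
theorem isCyclotomicExtension_adjoin_adjoin_half_trace {n : ℕ} [NeZero n] {ζ : ℂ}
    (hζ : IsPrimitiveRoot ζ n) {c : ℝ} (hc : 2 * (c : ℂ) = ζ + ζ⁻¹) {F : IntermediateField ℚ ℝ}
    (hF : F = ℚ⟮c⟯) : IsCyclotomicExtension {n} ℚ F⟮ζ⟯ := by
  have hζQ : IsCyclotomicExtension {n} ℚ ℚ⟮ζ⟯ := by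
    have hint : IsIntegral ℚ ζ := (hζ.isIntegral (NeZero.pos n)).tower_top
    have := hζ.adjoin_isCyclotomicExtension ℚ
    exact this.equiv _ _ _
      (Subalgebra.equivOfEq _ _ (adjoin_simple_toSubalgebra_of_isAlgebraic hint.isAlgebraic).symm)
  suffices h : F⟮ζ⟯.restrictScalars ℚ = ℚ⟮ζ⟯ by
    rw [← h] at hζQ
    exact hζQ
  have hcζ : (c : ℂ) ∈ ℚ⟮ζ⟯ := by
    have hζ' := mem_adjoin_simple_self ℚ ζ
    have : (c : ℂ) = (ζ + ζ⁻¹) / 2 := by rw [← hc]; ring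
    rw [this]
    exact div_mem (add_mem hζ' (inv_mem hζ')) (ofNat_mem _ 2)
  have hle : F ≤ ℚ⟮ζ⟯.comap (Complex.ofRealAm.restrictScalars ℚ) := by
    rw [hF, adjoin_simple_le_iff]
    exact hcζ
  apply le_antisymm
  · intro x hx
    have : F⟮ζ⟯.toSubfield ≤ ℚ⟮ζ⟯.toSubfield := by
      change Subfield.closure _ ≤ _
      rw [Subfield.closure_le]
      rintro _ (⟨y, rfl⟩ | rfl)
      · exact hle y.2
      · exact mem_adjoin_simple_self ℚ _
    exact this hx
  · rw [adjoin_simple_le_iff]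
    exact mem_adjoin_simple_self F ζ

/-- A subfield `F` of `ℝ` containing `c = (ζ + ζ⁻¹) / 2`, where `ζ` is not real, satisfies
`[F(ζ) : F] = 2`. -/
theorem finrank_adjoin_eq_two_of_half_trace_mem {ζ : ℂ} (hζ : ζ.im ≠ 0) {c : ℝ}
    (hc : 2 * (c : ℂ) = ζ + ζ⁻¹) {F : IntermediateField ℚ ℝ} (hF : c ∈ F) :
    Module.finrank F F⟮ζ⟯ = 2 := by
  have hζ0 : ζ ≠ 0 := by rintro rfl; simp at hζ
  let b : F := 2 * ⟨c, hF⟩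
  let p : Polynomial F := .X ^ 2 + (.C (-b) * .X + .C 1)
  have hdeg : (Polynomial.C (-b) * .X + .C 1).degree < 2 :=
    Polynomial.degree_linear_le.trans_lt (by norm_num)
  have hp : p.Monic := Polynomial.monic_X_pow_add hdeg
  have hbζ : algebraMap F ℂ b = ζ + ζ⁻¹ := by
    rw [← hc]
    change (((2 * c : ℝ)) : ℂ) = _
    push_cast
    rfl
  have hroot : Polynomial.aeval ζ p = 0 := by
    simp only [p, map_add, map_mul, map_pow, Polynomial.aeval_X, Polynomial.aeval_C, map_neg, hbζ,
      map_one]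
    field_simp
    ring
  have hint : IsIntegral F ζ := ⟨p, hp, by simpa [Polynomial.aeval_def] using hroot⟩
  rw [adjoin.finrank hint]
  have hle : (minpoly F ζ).natDegree ≤ 2 := by
    refine (Polynomial.natDegree_le_natDegree (minpoly.min F ζ hp hroot)).trans ?_
    exact Polynomial.natDegree_le_of_degree_le
      (Polynomial.degree_add_le_of_degree_le (Polynomial.degree_X_pow_le 2) hdeg.le)
  have hne : (minpoly F ζ).natDegree ≠ 1 := by
    rw [Ne, minpoly.natDegree_eq_one_iff]
    rintro ⟨y, rfl⟩
    exact hζ (Complex.ofReal_im y.1)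
  have := minpoly.natDegree_pos hint
  lia

theorem two_mul_cos_eq_exp_add_inv (n : ℕ) :
    2 * ((Real.cos (2 * Real.pi / n) : ℝ) : ℂ) =
      Complex.exp (2 * Real.pi * Complex.I / n) + (Complex.exp (2 * Real.pi * Complex.I / n))⁻¹ := by
  rw [← Complex.exp_neg, Complex.ofReal_cos, Complex.two_cos]
  push_cast
  congr 2 <;> ring

theorem isCyclotomicExtension_adjoin_exp {n : ℕ} [NeZero n] {F : IntermediateField ℚ ℝ}
    (hF : F = ℚ⟮Real.cos (2 * Real.pi / n)⟯) :
    IsCyclotomicExtension {n} ℚ F⟮Complex.exp (2 * Real.pi * Complex.I / n)⟯ :=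
  isCyclotomicExtension_adjoin_adjoin_half_trace (Complex.isPrimitiveRoot_exp n (NeZero.ne n))
    (two_mul_cos_eq_exp_add_inv n) hF

/-- The field `ℚ(cos(2π/n))` has degree `φ(n)/2`. -/
theorem finrank_adjoin_cos {n : ℕ} (hn : 3 ≤ n) {F : IntermediateField ℚ ℝ}
    (hF : F = ℚ⟮Real.cos (2 * Real.pi / n)⟯) : Module.finrank ℚ F = n.totient / 2 := by
  have : NeZero n := ⟨by lia⟩
  have := isCyclotomicExtension_adjoin_exp hF
  have him : (Complex.exp (2 * Real.pi * Complex.I / n)).im ≠ 0 := by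
    have : (2 * Real.pi * Complex.I / n : ℂ) = ((2 * Real.pi / n : ℝ) : ℂ) * Complex.I := by
      push_cast
      ring
    rw [this, Complex.exp_ofReal_mul_I_im]
    have hn' : (3 : ℝ) ≤ n := by exact_mod_cast hn
    refine (Real.sin_pos_of_pos_of_lt_pi (by positivity) ?_).ne'
    rw [div_lt_iff₀ (by positivity)]
    nlinarith [Real.pi_pos]
  have h2 := finrank_adjoin_eq_two_of_half_trace_mem him (two_mul_cos_eq_exp_add_inv n)
    (hF ▸ mem_adjoin_simple_self ℚ _)
  have hmul := Module.finrank_mul_finrank ℚ F F⟮Complex.exp (2 * Real.pi * Complex.I / n)⟯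
  rw [h2, IsCyclotomicExtension.Rat.finrank n
    F⟮Complex.exp (2 * Real.pi * Complex.I / n)⟯] at hmul
  lia

/-- The field `ℚ(cos(2π/n))` is an abelian extension of `ℚ`. -/
theorem isAbelianGalois_adjoin_cos {n : ℕ} [NeZero n] {F : IntermediateField ℚ ℝ}
    (hF : F = ℚ⟮Real.cos (2 * Real.pi / n)⟯) : IsAbelianGalois ℚ F := by
  have := isCyclotomicExtension_adjoin_exp hF
  have := IsCyclotomicExtension.isAbelianGalois {n} ℚ
    F⟮Complex.exp (2 * Real.pi * Complex.I / n)⟯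
  exact .tower_bot ℚ F F⟮Complex.exp (2 * Real.pi * Complex.I / n)⟯

/-- The discriminant of `ℚ(cos(2π/n))` divides that of the `n`-th cyclotomic field. -/
theorem natAbs_discr_adjoin_cos_dvd {n : ℕ} [NeZero n] {F : IntermediateField ℚ ℝ}
    [NumberField F] (hF : F = ℚ⟮Real.cos (2 * Real.pi / n)⟯) :
    (discr F).natAbs ∣
      n ^ n.totient / ∏ p ∈ n.primeFactors, p ^ (n.totient / (p - 1)) := by
  have := isCyclotomicExtension_adjoin_exp hF
  have := IsCyclotomicExtension.numberField {n} ℚ F⟮Complex.exp (2 * Real.pi * Complex.I / n)⟯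
  rw [← IsCyclotomicExtension.Rat.natAbs_discr n F⟮Complex.exp (2 * Real.pi * Complex.I / n)⟯,
    Int.natAbs_dvd_natAbs]
  exact discr_dvd_discr F _

theorem natAbs_discr_adjoin_cos_dvd_pow {n : ℕ} [NeZero n] {F : IntermediateField ℚ ℝ}
    [NumberField F] (hF : F = ℚ⟮Real.cos (2 * Real.pi / n)⟯) :
    (discr F).natAbs ∣ n ^ n.totient :=
  (natAbs_discr_adjoin_cos_dvd hF).trans
    (Nat.div_dvd_of_dvd (Nat.prod_primeFactors_pow_totient_ediv_dvd (NeZero.pos n)))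

theorem natAbs_discr_adjoin_cos_two_mul_dvd_pow {n m : ℕ} [NeZero n] (hnm : n = 2 * m)
    {F : IntermediateField ℚ ℝ} [NumberField F] (hF : F = ℚ⟮Real.cos (2 * Real.pi / n)⟯) :
    (discr F).natAbs ∣ m ^ n.totient := by
  refine (natAbs_discr_adjoin_cos_dvd hF).trans ?_
  have hdvd := Nat.prod_primeFactors_pow_totient_ediv_dvd (NeZero.pos n)
  have h2 : 2 ∈ n.primeFactors :=
    Nat.mem_primeFactors.mpr ⟨Nat.prime_two, ⟨m, hnm⟩, NeZero.ne n⟩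
  obtain ⟨r, hr⟩ := Finset.dvd_prod_of_mem (fun p ↦ p ^ (n.totient / (p - 1))) h2
  have hpow : n ^ n.totient = 2 ^ n.totient * m ^ n.totient := by
    rw [← mul_pow, ← hnm]
  rw [hr, hpow] at hdvd
  rw [hr, hpow]
  simp only [Nat.add_one_sub_one, Nat.div_one] at hdvd ⊢
  rw [Nat.mul_div_mul_left _ _ (by positivity)]
  exact Nat.div_dvd_of_dvd (Nat.dvd_of_mul_dvd_mul_left (by positivity) hdvd)

/-- If `gcd(k, s)` divides `2`, then the discriminants of `ℚ(cos(2π/k))` and `ℚ(cos(2π/s))` are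
coprime. -/
theorem isCoprime_discr_adjoin_cos {k s : ℕ} [NeZero k] [NeZero s] (h : Nat.gcd k s ∣ 2)
    {Fk Fs : IntermediateField ℚ ℝ} [NumberField Fk] [NumberField Fs]
    (hFk : Fk = ℚ⟮Real.cos (2 * Real.pi / k)⟯) (hFs : Fs = ℚ⟮Real.cos (2 * Real.pi / s)⟯) :
    IsCoprime (discr Fk) (discr Fs) := by
  rw [Int.isCoprime_iff_nat_coprime]
  have of_pow {a b i j x y : ℕ} (hab : a.Coprime b) (hx : x ∣ a ^ i) (hy : y ∣ b ^ j) :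
      x.Coprime y :=
    ((hab.pow i j).coprime_dvd_left hx).coprime_dvd_right hy
  rcases (Nat.dvd_prime Nat.prime_two).mp h with h1 | h2
  · exact of_pow h1 (natAbs_discr_adjoin_cos_dvd_pow hFk) (natAbs_discr_adjoin_cos_dvd_pow hFs)
  obtain ⟨a, ha⟩ : 2 ∣ k := h2 ▸ Nat.gcd_dvd_left k s
  obtain ⟨b, hb⟩ : 2 ∣ s := h2 ▸ Nat.gcd_dvd_right k s
  have hab : a.Coprime b := by
    rw [ha, hb, Nat.gcd_mul_left] at h2
    exact Nat.eq_of_mul_eq_mul_left two_pos h2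
  exact of_pow hab (natAbs_discr_adjoin_cos_two_mul_dvd_pow ha hFk)
    (natAbs_discr_adjoin_cos_two_mul_dvd_pow hb hFs)

theorem IntermediateField.isGalois_restrict {K L : Type*} [Field K] [Field L] [Algebra K L]
    {F E : IntermediateField K L} (hF : IsGalois K F) (h : F ≤ E) : IsGalois K (restrict h) :=
  .of_algEquiv (restrictAlgEquiv h)

theorem IntermediateField.restrict_sup_restrict_eq_top {K L : Type*} [Field K] [Field L]
    [Algebra K L] {F₁ F₂ E : IntermediateField K L} (hE : F₁ ⊔ F₂ = E) (h₁ : F₁ ≤ E)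
    (h₂ : F₂ ≤ E) : restrict h₁ ⊔ restrict h₂ = ⊤ := by
  apply lift_injective E
  rw [lift_sup, lift_restrict, lift_restrict, lift_top, hE]

/-- Multiplicativity of the discriminant for the compositum of two subfields of a field of
characteristic zero with coprime discriminants, one of which is Galois over `ℚ`. -/
theorem natAbs_discr_sup_of_isCoprime {L : Type*} [Field L] [CharZero L]
    {K₁ K₂ E : IntermediateField ℚ L} [NumberField K₁] [NumberField K₂] [NumberField E]
    [IsGalois ℚ K₁] (hE : K₁ ⊔ K₂ = E) (h : IsCoprime (discr K₁) (discr K₂)) :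
    (discr E).natAbs =
      (discr K₁).natAbs ^ Module.finrank ℚ K₂ * (discr K₂).natAbs ^ Module.finrank ℚ K₁ := by
  have h₁ : K₁ ≤ E := hE ▸ le_sup_left
  have h₂ : K₂ ≤ E := hE ▸ le_sup_right
  let e₁ := restrictAlgEquiv h₁
  let e₂ := restrictAlgEquiv h₂
  rw [discr_eq_discr_of_algEquiv _ e₁, discr_eq_discr_of_algEquiv _ e₂] at h ⊢
  rw [e₁.toLinearEquiv.finrank_eq, e₂.toLinearEquiv.finrank_eq]
  have : IsGalois ℚ (restrict h₁) := isGalois_restrict ‹_› h₁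
  exact natAbs_discr_eq_natAbs_discr_pow_mul_natAbs_discr_pow E _ _
    (linearDisjoint_of_isGalois_isCoprime_discr E _ _ h) (restrict_sup_restrict_eq_top hE h₁ h₂)
    (isCoprime_differentIdeal_of_isCoprime_discr E h)

/-- Let `k, s ≥ 3` be integers with `gcd(k,s) ∣ 2`.  Then the discriminant of
`F_{k,s} = ℚ(cos(2π/k), cos(2π/s))` satisfies
`|discr F_{k,s}| = |discr F_k|^{φ(s)/2} |discr F_s|^{φ(k)/2}`, where
`F_k = ℚ(cos(2π/k))` and `F_s = ℚ(cos(2π/s))`. -/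
theorem discr_Fks (k s : ℕ) (hk : 3 ≤ k) (hs : 3 ≤ s) (h : Nat.gcd k s ∣ 2)
    (Fk : IntermediateField ℚ ℝ)
    (hFk : Fk = IntermediateField.adjoin ℚ {Real.cos (2 * Real.pi / k)})
    [NumberField Fk]
    (Fs : IntermediateField ℚ ℝ)
    (hFs : Fs = IntermediateField.adjoin ℚ {Real.cos (2 * Real.pi / s)})
    [NumberField Fs]
    (Fks : IntermediateField ℚ ℝ)
    (hFks : Fks = IntermediateField.adjoin ℚ
      {Real.cos (2 * Real.pi / k), Real.cos (2 * Real.pi / s)})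
    [NumberField Fks] :
    (NumberField.discr Fks).natAbs =
      (NumberField.discr Fk).natAbs ^ (Nat.totient s / 2) *
        (NumberField.discr Fs).natAbs ^ (Nat.totient k / 2) := by
  have : NeZero k := ⟨by lia⟩
  have : NeZero s := ⟨by lia⟩
  have := isAbelianGalois_adjoin_cos hFk
  have hsup : Fk ⊔ Fs = Fks := by
    rw [hFk, hFs, hFks, ← adjoin_union, Set.singleton_union]
  rw [natAbs_discr_sup_of_isCoprime hsup (isCoprime_discr_adjoin_cos h hFk hFs),
    finrank_adjoin_cos hk hFk, finrank_adjoin_cos hs hFs]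
end
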